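/- arXiv:2308.08819 — 2 statements merged into one kernel-verified Lean document; each statement's English description precedes it below -/
import Mathlib

section
/- Fix δ ∈ 2^{−ℕ}, let 𝒫 be a set of distinct weighted dyadic δ-squares contained in [0,1)² with weight function w : 𝒫 → ℝ_{≥0}, and let 𝒯 be a set of distinct dyadic δ-tubes. If δ^{−ε/100} ≤ S ≤ δ^{−1}, then I_w(𝒫, 𝒯) ≲_ε ( S δ^{−1} |𝒯| Σ_{p∈𝒫} w(p)² )^{1/2} + S^{−1+ε} I_w(𝒫, 𝒯^{Sδ}), where 𝒯^{Sδ} := { T^{Sδ} : T ∈ 𝒯 } is counted with multiplicity. -/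
open Set Metric
open scoped Classical

noncomputable section

/-- The half-open dyadic square of side-length `δ` with index `q`. -/
def dSq (δ : ℝ) (q : ℤ × ℤ) : Set (ℝ × ℝ) :=
  Set.Ico ((q.1 : ℝ) * δ) (((q.1 : ℝ) + 1) * δ) ×ˢ Set.Ico ((q.2 : ℝ) * δ) (((q.2 : ℝ) + 1) * δ)

/-- The dyadic `δ`-covering number of a planar set. -/
def covNum (δ : ℝ) (P : Set (ℝ × ℝ)) : ℕ :=
  Nat.card {q : ℤ × ℤ | (dSq δ q ∩ P).Nonempty}

/-- The dyadic `δ`-covering number of a set of reals. -/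
def covNum1 (δ : ℝ) (A : Set ℝ) : ℕ :=
  Nat.card {k : ℤ | (Set.Ico ((k : ℝ) * δ) (((k : ℝ) + 1) * δ) ∩ A).Nonempty}

/-- `A` is a `(δ, s, C)`-set in the plane. -/
def IsDSSet (δ s C : ℝ) (A : Set (ℝ × ℝ)) : Prop :=
  ∀ (x : ℝ × ℝ) (r : ℝ), δ ≤ r → r ≤ 1 →
    (covNum δ (A ∩ Metric.ball x r) : ℝ) ≤ C * r ^ s * (covNum δ A : ℝ)

/-- The line `y = a x + b`, dual to the point `(a, b)`. -/
def dualLine (a b : ℝ) : Set (ℝ × ℝ) := {z : ℝ × ℝ | z.2 = a * z.1 + b}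

/-- The dyadic `δ`-tube `D(p)`, the union of the lines dual to points of the
dyadic `δ`-square with index `q`. -/
def dTube (δ : ℝ) (q : ℤ × ℤ) : Set (ℝ × ℝ) :=
  {z : ℝ × ℝ | ∃ ab ∈ dSq δ q, z.2 = ab.1 * z.1 + ab.2}

/-- The dyadic square with index `q` is contained in `[0,1)²`. -/
def sqInUnit (δ : ℝ) (q : ℤ × ℤ) : Prop :=
  dSq δ q ⊆ Set.Ico (0 : ℝ) 1 ×ˢ Set.Ico (0 : ℝ) 1

/-- The dyadic `δ`-square with index `q` is contained in `[−1,1] × ℝ`, so that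
`dTube δ q` is a legitimate dyadic `δ`-tube. -/
def tubeIdx (δ : ℝ) (q : ℤ × ℤ) : Prop :=
  (-1 : ℝ) ≤ (q.1 : ℝ) * δ ∧ ((q.1 : ℝ) + 1) * δ ≤ 1

/-- Index of the dyadic parent square/tube, when the scale is multiplied by `S`. -/
def parQ (S : ℤ) (q : ℤ × ℤ) : ℤ × ℤ := (Int.fdiv q.1 S, Int.fdiv q.2 S)

/-- The `c·ρ`-neighbourhood of the dyadic `ρ`-tube with index `q`; `c = 6` gives `6T`
and `c = 4` gives `4T`. -/
def nbTube (c ρ : ℝ) (q : ℤ × ℤ) : Set (ℝ × ℝ) :=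
  Metric.cthickening (c * ρ) (dTube ρ q)

/-- The union of the dyadic `δ`-squares indexed by a finite set. -/
def sqUnion (δ : ℝ) (P : Finset (ℤ × ℤ)) : Set (ℝ × ℝ) := ⋃ p ∈ P, dSq δ p

/-- `(𝒫, 𝒯)` is a `(δ, s, C, M)`-nice configuration: every `p ∈ 𝒫` carries a
`(δ, s, C)`-set `𝒯(p) ⊆ 𝒯` of tubes meeting `p`, with `|𝒯(p)| ∼ M`. -/
def NiceConfig (δ s C : ℝ) (M : ℕ) (P T : Finset (ℤ × ℤ))
    (Tp : ℤ × ℤ → Finset (ℤ × ℤ)) : Prop :=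
  (∀ p ∈ P, sqInUnit δ p) ∧ (∀ t ∈ T, tubeIdx δ t) ∧
  ∀ p ∈ P, Tp p ⊆ T ∧ IsDSSet δ s C (sqUnion δ (Tp p)) ∧
    (M : ℝ) ≤ 2 * ((Tp p).card : ℝ) ∧ ((Tp p).card : ℝ) ≤ 2 * (M : ℝ) ∧
    ∀ t ∈ Tp p, (dTube δ t ∩ dSq δ p).Nonempty



/-- Weighted incidence count between dyadic `δ`-squares (with weights `w`) and the
dyadic `Δ`-tubes obtained from the `δ`-tubes in `T` (counted with multiplicity) by
passing to dyadic ancestors with index map `par`; the squares are likewise replaced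
by their dyadic `Δ`-ancestors.  For `par = id` and `Δ = δ` this is `I_w(𝒫, 𝒯)`. -/
def incW (δ Δ : ℝ) (par : ℤ × ℤ → ℤ × ℤ) (P T : Finset (ℤ × ℤ))
    (w : ℤ × ℤ → ℝ) : ℝ :=
  ∑ p ∈ P, ∑ t ∈ T, if dSq Δ (par p) ⊆ nbTube 6 Δ (par t) then w p else 0

section HighLowAux

open MeasureTheory


def hlF (v : ℝ) : ℝ := max 0 (min 1 (22 - |v|))

lemma hlF_cont : Continuous hlF := by unfold hlF; fun_prop
lemma hlF_nonneg (v : ℝ) : 0 ≤ hlF v := le_max_left _ _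
lemma hlF_le_one (v : ℝ) : hlF v ≤ 1 := by simp [hlF]
lemma hlF_eq_one (v : ℝ) (h : |v| ≤ 21) : hlF v = 1 := by
  unfold hlF; rw [min_eq_left (by linarith), max_eq_right zero_le_one]
lemma hlF_eq_zero (v : ℝ) (h : 22 ≤ |v|) : hlF v = 0 := by
  unfold hlF; rw [max_eq_left]; exact (min_le_right _ _).trans (by linarith)
lemma hlF_neg (v : ℝ) : hlF (-v) = hlF v := by simp [hlF]
lemma hlF_cs : HasCompactSupport hlF := by
  refine HasCompactSupport.intro (isCompact_Icc (a := (-22:ℝ)) (b := 22)) fun x hx => hlF_eq_zero x ?_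
  by_contra! h
  exact hx ⟨by linarith [(abs_lt.1 h).1], by linarith [(abs_lt.1 h).2]⟩
lemma hlF_int : Integrable hlF := hlF_cont.integrable_of_hasCompactSupport hlF_cs

/-- antiderivative of `hlF` -/
def hlPhi (v : ℝ) : ℝ := ∫ t in (0:ℝ)..v, hlF t

lemma hlPhi_deriv (v : ℝ) : HasDerivAt hlPhi (hlF v) v :=
  intervalIntegral.integral_hasDerivAt_right (hlF_cont.intervalIntegrable _ _)
    (hlF_cont.stronglyMeasurableAtFilter _ _) hlF_cont.continuousAt

lemma hlPhi_ge (v : ℝ) (h : 22 ≤ v) : hlPhi v = hlPhi 22 := by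
  have h1 : hlPhi 22 + ∫ t in (22:ℝ)..v, hlF t = hlPhi v :=
    intervalIntegral.integral_add_adjacent_intervals (hlF_cont.intervalIntegrable _ _)
      (hlF_cont.intervalIntegrable _ _)
  have h2 : ∫ t in (22:ℝ)..v, hlF t = ∫ t in (22:ℝ)..v, (0:ℝ) := by
    apply intervalIntegral.integral_congr
    intro t ht
    rw [uIcc_of_le h] at ht
    exact hlF_eq_zero t (ht.1.trans (le_abs_self _))
  rw [← h1, h2]; simp

lemma hlPhi_neg (v : ℝ) : hlPhi (-v) = - hlPhi v := by
  have := intervalIntegral.integral_comp_neg (f := hlF) (a := 0) (b := v)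
  unfold hlPhi
  rw [neg_zero] at this
  rw [intervalIntegral.integral_symm (-v) 0, ← this]
  simp [hlF_neg]

lemma hlPhi_mono : Monotone hlPhi :=
  monotone_of_deriv_nonneg (fun v => (hlPhi_deriv v).differentiableAt)
    fun v => by rw [(hlPhi_deriv v).deriv]; exact hlF_nonneg v

lemma hlPhi_le (v : ℝ) : hlPhi v ≤ hlPhi 22 := by
  rcases le_total 22 v with h | h
  · rw [hlPhi_ge v h]
  · exact hlPhi_mono h

lemma hlPhi_22 : 0 ≤ hlPhi 22 := by
  have : hlPhi 0 = 0 := by simp [hlPhi]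
  rw [← this]; exact hlPhi_mono (by norm_num)

lemma hlPhi_abs (v : ℝ) : |hlPhi v| ≤ hlPhi 22 := by
  rw [abs_le]
  refine ⟨?_, hlPhi_le v⟩
  have := hlPhi_le (-v)
  rw [hlPhi_neg] at this; linarith

def hlk (s v : ℝ) : ℝ := hlF v - s⁻¹ * hlF (v / s)
def hlkap (s v : ℝ) : ℝ := hlPhi v - hlPhi (v / s)

lemma hlkap_deriv (s v : ℝ) : HasDerivAt (hlkap s) (hlk s v) v := by
  have h1 : HasDerivAt (fun v : ℝ => v / s) (s⁻¹) v := by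
    simpa using (hasDerivAt_id v).div_const s
  have h2 := (hlPhi_deriv (v / s)).comp v h1
  have := (hlPhi_deriv v).sub h2
  rw [mul_comm] at this
  exact this

lemma hlk_cont (s : ℝ) : Continuous (hlk s) := by
  have := hlF_cont
  unfold hlk; fun_prop
lemma hlkap_cont (s : ℝ) : Continuous (hlkap s) :=
  continuous_iff_continuousAt.2 fun v => (hlkap_deriv s v).continuousAt

lemma hlkap_zero {S : ℝ} (hS : 1 ≤ S) (v : ℝ) (h : 22 * S ≤ |v|) : hlkap (S / 5) v = 0 := by
  have key : ∀ v : ℝ, 22 * S ≤ v → hlkap (S/5) v = 0 := by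
    intro v hv
    unfold hlkap
    rw [hlPhi_ge v (by linarith), hlPhi_ge (v / (S/5)), sub_self]
    rw [le_div_iff₀ (by positivity)]; linarith
  rcases le_total 0 v with h0 | h0
  · rw [abs_of_nonneg h0] at h; exact key v h
  · rw [abs_of_nonpos h0] at h
    have := key (-v) h
    unfold hlkap at *
    rw [neg_div, hlPhi_neg, hlPhi_neg] at this
    linarith

lemma hlk_zero {S : ℝ} (hS : 1 ≤ S) (v : ℝ) (h : 22 * S ≤ |v|) : hlk (S / 5) v = 0 := by
  unfold hlk
  rw [hlF_eq_zero v (by linarith), hlF_eq_zero (v / (S/5))]; simp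
  rw [abs_div, abs_of_pos (by positivity : 0 < S/5), le_div_iff₀ (by positivity)]; linarith

lemma cs_of_zero {f : ℝ → ℝ} (R : ℝ) (h : ∀ v, R ≤ |v| → f v = 0) : HasCompactSupport f := by
  refine HasCompactSupport.intro (isCompact_Icc (a := -R) (b := R)) fun x hx => h x ?_
  by_contra! h
  exact hx ⟨by linarith [(abs_lt.1 h).1], by linarith [(abs_lt.1 h).2]⟩

lemma hlk_cs {S : ℝ} (hS : 1 ≤ S) : HasCompactSupport (hlk (S/5)) := cs_of_zero _ (hlk_zero hS)
lemma hlkap_cs {S : ℝ} (hS : 1 ≤ S) : HasCompactSupport (hlkap (S/5)) :=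
  cs_of_zero _ (hlkap_zero hS)

lemma hlk_abs {s : ℝ} (hs : 0 < s) (v : ℝ) : |hlk s v| ≤ hlF v + s⁻¹ * hlF (v / s) := by
  unfold hlk
  have h1 := hlF_nonneg v
  have h2 : 0 ≤ s⁻¹ * hlF (v / s) := mul_nonneg (by positivity) (hlF_nonneg _)
  rw [abs_le]; constructor <;> linarith

lemma hlk_neg (s v : ℝ) : hlk s (-v) = hlk s v := by
  unfold hlk; rw [neg_div, hlF_neg, hlF_neg]

lemma hlkap_abs (s v : ℝ) : |hlkap s v| ≤ 2 * hlPhi 22 := by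
  have h1 := abs_le.1 (hlPhi_abs v)
  have h2 := abs_le.1 (hlPhi_abs (v/s))
  unfold hlkap
  rw [abs_le]; constructor <;> linarith

/-- counting integers in an interval -/
lemma card_int_le (U : Finset ℤ) (t R : ℝ) (hR : 0 ≤ R) (h : ∀ b ∈ U, |(b:ℝ) + t| ≤ R) :
    (U.card : ℝ) ≤ 2 * R + 1 := by
  have hsub : U ⊆ Finset.Icc ⌈-R - t⌉ ⌊R - t⌋ := by
    intro b hb
    have := abs_le.1 (h b hb)
    rw [Finset.mem_Icc, Int.ceil_le, Int.le_floor]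
    constructor <;> linarith
  have h1 := Finset.card_le_card hsub
  rw [Int.card_Icc] at h1
  have h2 : (U.card : ℝ) ≤ ((⌊R - t⌋ + 1 - ⌈-R - t⌉).toNat : ℝ) := by exact_mod_cast h1
  have h3 : (((⌊R - t⌋ + 1 - ⌈-R - t⌉).toNat : ℤ) : ℝ) ≤ 2 * R + 1 := by
    rw [Int.toNat_eq_max, Int.cast_max]
    apply max_le
    · push_cast
      have := Int.floor_le (R - t)
      have := Int.le_ceil (-R - t)
      linarith
    · push_cast; linarith
  exact h2.trans (by exact_mod_cast h3)

/-- bounding a sum over integers of a compactly supported function -/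
lemma sum_int_le (f : ℝ → ℝ) (R D : ℝ) (hR : 0 ≤ R) (hD : ∀ v, |f v| ≤ D)
    (hf : ∀ v, R ≤ |v| → f v = 0) (U : Finset ℤ) (t : ℝ) :
    ∑ b ∈ U, |f ((b:ℝ) + t)| ≤ (2 * R + 1) * D := by
  have hD0 : 0 ≤ D := (abs_nonneg _).trans (hD 0)
  have : ∑ b ∈ U, |f ((b:ℝ) + t)| = ∑ b ∈ U.filter (fun b : ℤ => |(b:ℝ) + t| ≤ R), |f ((b:ℝ) + t)| := by
    rw [Finset.sum_filter]
    refine Finset.sum_congr rfl fun b _ => ?_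
    split_ifs with h
    · rfl
    · rw [hf _ (not_le.1 h).le, abs_zero]
  rw [this]
  refine (Finset.sum_le_card_nsmul _ _ D fun b _ => hD _).trans ?_
  rw [nsmul_eq_mul]
  refine mul_le_mul_of_nonneg_right ?_ hD0
  exact card_int_le _ t R hR fun b hb => (Finset.mem_filter.1 hb).2

lemma hlk_sum {S : ℝ} (hS : 1 ≤ S) (U : Finset ℤ) (t : ℝ) :
    ∑ b ∈ U, |hlk (S/5) ((b:ℝ) + t)| ≤ 100 := by
  have hs : 0 < S/5 := by positivity
  have h1 := sum_int_le hlF 22 1 (by norm_num)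
    (fun v => by rw [abs_of_nonneg (hlF_nonneg v)]; exact hlF_le_one v) hlF_eq_zero U t
  have h2 := sum_int_le (fun v => (S/5)⁻¹ * hlF (v / (S/5))) (22 * (S/5)) ((S/5)⁻¹) (by positivity)
    (fun v => by
      rw [abs_of_nonneg (mul_nonneg (by positivity) (hlF_nonneg _))]
      exact mul_le_of_le_one_right (by positivity) (hlF_le_one _))
    (fun v hv => by
      rw [hlF_eq_zero, mul_zero]
      rw [abs_div, abs_of_pos hs, le_div_iff₀ hs]; exact hv) U t
  have h3 : (2 * (22 * (S/5)) + 1) * (S/5)⁻¹ ≤ 49 := by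
    rw [mul_inv_le_iff₀ hs]; linarith
  calc _ ≤ ∑ b ∈ U, (|hlF ((b:ℝ)+t)| + |(S/5)⁻¹ * hlF (((b:ℝ)+t) / (S/5))|) :=
        Finset.sum_le_sum fun b _ => abs_sub _ _
    _ ≤ 100 := by rw [Finset.sum_add_distrib]; linarith

lemma hlk_l1 {S : ℝ} (hS : 1 ≤ S) : ∫ v, |hlk (S/5) v| ≤ 2 * ∫ v, hlF v := by
  have hs : 0 < S/5 := by positivity
  have hi : Integrable fun v => (S/5)⁻¹ * hlF (v / (S/5)) :=
    (hlF_int.comp_div hs.ne').const_mul _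
  calc _ ≤ ∫ v, (hlF v + (S/5)⁻¹ * hlF (v / (S/5))) := by
        apply integral_mono _ (hlF_int.add hi) (fun v => hlk_abs hs v)
        exact ((hlk_cont _).integrable_of_hasCompactSupport (hlk_cs hS)).abs
    _ = _ := by
        rw [integral_add hlF_int hi, integral_const_mul, Measure.integral_comp_div,
          abs_of_pos hs, smul_eq_mul, inv_mul_cancel_left₀ hs.ne']; ring
open scoped Convolution

def hlA (s : ℝ) : ℝ → ℝ := (hlk s) ⋆[ContinuousLinearMap.mul ℝ ℝ, volume] (hlk s)
def hlA1 (s : ℝ) : ℝ → ℝ := (hlkap s) ⋆[ContinuousLinearMap.mul ℝ ℝ, volume] (hlk s)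
def hlB (s : ℝ) : ℝ → ℝ := (hlkap s) ⋆[ContinuousLinearMap.mul ℝ ℝ, volume] (hlkap s)

lemma hlA_eq (s c : ℝ) : hlA s c = ∫ t, hlk s t * hlk s (c - t) := rfl
lemma hlB_eq (s c : ℝ) : hlB s c = ∫ t, hlkap s t * hlkap s (c - t) := rfl

lemma hlkap_deriv_eq (s : ℝ) : deriv (hlkap s) = hlk s := funext fun v => (hlkap_deriv s v).deriv

lemma hlkap_C1 (s : ℝ) : ContDiff ℝ 1 (hlkap s) := by
  rw [contDiff_one_iff_deriv, hlkap_deriv_eq]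
  exact ⟨fun v => (hlkap_deriv s v).differentiableAt, hlk_cont s⟩

lemma hlB_deriv {S : ℝ} (hS : 1 ≤ S) (c : ℝ) : HasDerivAt (hlB (S/5)) (hlA1 (S/5) c) c := by
  have := (hlkap_cs hS).hasDerivAt_convolution_right (ContinuousLinearMap.mul ℝ ℝ) (μ := volume)
    (hlkap_cont (S/5)).locallyIntegrable (hlkap_C1 (S/5)) c
  rw [hlkap_deriv_eq] at this
  exact this

lemma hlA1_deriv {S : ℝ} (hS : 1 ≤ S) (c : ℝ) : HasDerivAt (hlA1 (S/5)) (hlA (S/5) c) c := by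
  have := (hlkap_cs hS).hasDerivAt_convolution_left (ContinuousLinearMap.mul ℝ ℝ) (μ := volume)
    (hlkap_C1 (S/5)) (hlk_cont (S/5)).locallyIntegrable c
  rw [hlkap_deriv_eq] at this
  exact this

lemma hlA_cont {S : ℝ} (hS : 1 ≤ S) : Continuous (hlA (S/5)) :=
  (hlk_cs hS).continuous_convolution_right _ (hlk_cont _).locallyIntegrable (hlk_cont _)
lemma hlA1_cont {S : ℝ} (hS : 1 ≤ S) : Continuous (hlA1 (S/5)) :=
  continuous_iff_continuousAt.2 fun v => (hlA1_deriv hS v).continuousAt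
lemma hlB_cont {S : ℝ} (hS : 1 ≤ S) : Continuous (hlB (S/5)) :=
  continuous_iff_continuousAt.2 fun v => (hlB_deriv hS v).continuousAt

lemma hlA_sum {S : ℝ} (hS : 1 ≤ S) (U : Finset ℤ) (t : ℝ) :
    ∑ b ∈ U, |hlA (S/5) ((b:ℝ) + t)| ≤ 200 * ∫ v, hlF v := by
  have hki : Integrable (fun v => |hlk (S/5) v|) :=
    ((hlk_cont _).integrable_of_hasCompactSupport (hlk_cs hS)).abs
  have hint : ∀ b : ℤ, Integrable fun v => |hlk (S/5) v| * |hlk (S/5) ((b:ℝ) + t - v)| := by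
    intro b
    apply Continuous.integrable_of_hasCompactSupport
    · have := hlk_cont (S/5); fun_prop
    · exact HasCompactSupport.mul_right ((hlk_cs hS).abs)
  calc _ ≤ ∑ b ∈ U, ∫ v, |hlk (S/5) v| * |hlk (S/5) ((b:ℝ) + t - v)| := by
        refine Finset.sum_le_sum fun b _ => ?_
        rw [hlA_eq]
        refine (abs_integral_le_integral_abs).trans_eq ?_
        simp_rw [abs_mul]
    _ = ∫ v, ∑ b ∈ U, |hlk (S/5) v| * |hlk (S/5) ((b:ℝ) + t - v)| :=
        (integral_finsetSum _ fun b _ => hint b).symm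
    _ ≤ ∫ v, |hlk (S/5) v| * 100 := by
        refine integral_mono (integrable_finsetSum _ fun b _ => hint b) (hki.mul_const _) fun v => ?_
        simp only
        rw [← Finset.mul_sum]
        refine mul_le_mul_of_nonneg_left ?_ (abs_nonneg _)
        simp_rw [add_sub_assoc]
        exact hlk_sum hS U (t - v)
    _ ≤ _ := by
        rw [integral_mul_const]; linarith [hlk_l1 hS]

lemma hlB_zero {S : ℝ} (hS : 1 ≤ S) (c : ℝ) (h : 44 * S ≤ |c|) : hlB (S/5) c = 0 := by
  rw [hlB_eq]
  have : ∀ t, hlkap (S/5) t * hlkap (S/5) (c - t) = 0 := by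
    intro t
    rcases le_total (22 * S) |t| with h1 | h1
    · rw [hlkap_zero hS t h1, zero_mul]
    · rw [hlkap_zero hS (c - t), mul_zero]
      have := abs_sub_abs_le_abs_sub c t
      linarith
  simp [this]

lemma hlB_abs {S : ℝ} (hS : 1 ≤ S) (c : ℝ) : |hlB (S/5) c| ≤ 176 * (hlPhi 22)^2 * S := by
  rw [hlB_eq]
  have h1 : ∫ t, hlkap (S/5) t * hlkap (S/5) (c - t) =
      ∫ t in (-(22*S))..(22*S), hlkap (S/5) t * hlkap (S/5) (c - t) := by
    rw [intervalIntegral.integral_of_le (by linarith)]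
    symm
    apply setIntegral_eq_integral_of_forall_compl_eq_zero
    intro t ht
    rw [hlkap_zero hS t, zero_mul]
    by_contra! h
    exact ht ⟨by linarith [(abs_lt.1 h).1], by linarith [(abs_lt.1 h).2]⟩
  rw [h1]
  have := intervalIntegral.norm_integral_le_of_norm_le_const (a := -(22*S)) (b := 22*S)
    (f := fun t => hlkap (S/5) t * hlkap (S/5) (c - t)) (C := (2 * hlPhi 22) * (2 * hlPhi 22)) (by
      intro t _
      rw [norm_mul]
      exact mul_le_mul (hlkap_abs _ _) (hlkap_abs _ _) (abs_nonneg _)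
        (by linarith [hlPhi_22]))
  rw [Real.norm_eq_abs] at this
  refine this.trans_eq ?_
  rw [abs_of_nonneg (by linarith)]; ring

lemma hlB_sum {S : ℝ} (hS : 1 ≤ S) (U : Finset ℤ) (t : ℝ) :
    ∑ b ∈ U, |hlB (S/5) ((b:ℝ) + t)| ≤ 89 * 176 * (hlPhi 22)^2 * S^2 := by
  refine (sum_int_le (hlB (S/5)) (44*S) _ (by linarith) (hlB_abs hS) (hlB_zero hS) U t).trans ?_
  have : 0 ≤ 176 * (hlPhi 22)^2 * S := by positivity
  nlinarith

/-- a smooth cutoff -/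
lemma exists_chi : ∃ χ χ1 χ2 : ℝ → ℝ, Continuous χ ∧ Continuous χ1 ∧ Continuous χ2 ∧
    (∀ x, HasDerivAt χ (χ1 x) x) ∧ (∀ x, HasDerivAt χ1 (χ2 x) x) ∧ (∀ x, 0 ≤ χ x) ∧
    (∀ x, |x| ≤ 1 → χ x = 1) ∧ (∀ x, 2 ≤ |x| → χ x = 0) ∧
    HasCompactSupport χ ∧ HasCompactSupport χ1 ∧ HasCompactSupport χ2 := by
  let f : ContDiffBump (0:ℝ) := ⟨1, 2, by norm_num, by norm_num⟩
  have hf : ContDiff ℝ 2 f := f.contDiff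
  have hf' : ContDiff ℝ (1 + 1) f := f.contDiff
  have h1 : ContDiff ℝ 1 (deriv f) := by
    have := (contDiff_succ_iff_deriv (n := 1) (f := f) (𝕜 := ℝ)).1 hf'
    exact this.2.2
  have h2 := contDiff_one_iff_deriv.1 h1
  refine ⟨f, deriv f, deriv (deriv f), f.continuous, h1.continuous, h2.2, ?_, ?_, fun x => f.nonneg,
    ?_, ?_, f.hasCompactSupport, f.hasCompactSupport.deriv, f.hasCompactSupport.deriv.deriv⟩
  · intro x; exact (hf.differentiable (by norm_num) x).hasDerivAt
  · intro x; exact (h2.1 x).hasDerivAt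
  · intro x hx; apply f.one_of_mem_closedBall; simpa using hx
  · intro x hx; apply f.zero_of_le_dist; simpa using hx

lemma ibp {χ χ1 A A1 : ℝ → ℝ} (hχ : Continuous χ) (hχ1 : Continuous χ1)
    (hd : ∀ x, HasDerivAt χ (χ1 x) x) (hc : HasCompactSupport χ) (hc1 : HasCompactSupport χ1)
    (hA : Continuous A) (hA1 : ∀ c, HasDerivAt A1 (A c) c) (α β : ℝ) (hα : α ≠ 0) :
    ∫ x, χ x * A (β + α * x) = - α⁻¹ * ∫ x, χ1 x * A1 (β + α * x) := by
  have hA1c : Continuous A1 := continuous_iff_continuousAt.2 fun v => (hA1 v).continuousAt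
  have hv : ∀ x, HasDerivAt (fun x => α⁻¹ * A1 (β + α * x)) (A (β + α * x)) x := by
    intro x
    have h1 : HasDerivAt (fun x => β + α * x) α x := by
      simpa using ((hasDerivAt_id x).const_mul α).const_add β
    have := ((hA1 (β + α * x)).comp x h1).const_mul α⁻¹
    rwa [mul_comm (A _), inv_mul_cancel_left₀ hα] at this
  have := integral_mul_deriv_eq_deriv_mul_of_integrable (u := χ) (u' := χ1)
    (v := fun x => α⁻¹ * A1 (β + α * x)) (v' := fun x => A (β + α * x))
    (fun x _ => hd x) (fun x _ => hv x)
    (Continuous.integrable_of_hasCompactSupport (hχ.mul (by fun_prop)) hc.mul_right)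
    (Continuous.integrable_of_hasCompactSupport (hχ1.mul (by fun_prop)) hc1.mul_right)
    (Continuous.integrable_of_hasCompactSupport (hχ.mul (by fun_prop)) hc.mul_right)
  rw [this, ← integral_const_mul, ← integral_neg]
  congr 1; ext x; ring

/-- sum over integer shifts -/
lemma sum_shift {χ A : ℝ → ℝ} (hχ : Continuous χ) (hc : HasCompactSupport χ)
    (hA : Continuous A) (D : ℝ) (U : Finset ℤ) (hD : ∀ t : ℝ, ∑ b ∈ U, |A ((b:ℝ) + t)| ≤ D) (α : ℝ) :
    ∑ b ∈ U, |∫ x, χ x * A ((b:ℝ) + α * x)| ≤ D * ∫ x, |χ x| := by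
  have hint : ∀ b : ℤ, Integrable fun x => |χ x| * |A ((b:ℝ) + α * x)| := by
    intro b
    exact Continuous.integrable_of_hasCompactSupport (by fun_prop) (hc.abs.mul_right)
  calc _ ≤ ∑ b ∈ U, ∫ x, |χ x| * |A ((b:ℝ) + α * x)| := by
        refine Finset.sum_le_sum fun b _ => ?_
        refine (abs_integral_le_integral_abs).trans_eq ?_
        simp_rw [abs_mul]
    _ = ∫ x, ∑ b ∈ U, |χ x| * |A ((b:ℝ) + α * x)| :=
        (integral_finsetSum _ fun b _ => hint b).symm
    _ ≤ ∫ x, D * |χ x| := by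
        refine integral_mono (integrable_finsetSum _ fun b _ => hint b)
          ((hχ.integrable_of_hasCompactSupport hc).abs.const_mul _) fun x => ?_
        simp only
        rw [← Finset.mul_sum, mul_comm]
        exact mul_le_mul_of_nonneg_right (hD _) (abs_nonneg _)
    _ = _ := by rw [integral_const_mul]

/-- summing `min(1, S²/α²)` -/
lemma sum_alpha (S : ℕ) (hS : 1 ≤ S) (U : Finset ℤ) (C : ℝ) (hC : 0 ≤ C) (f : ℤ → ℝ)
    (h1 : ∀ a, f a ≤ C) (h2 : ∀ a, a ≠ 0 → f a ≤ C * (S:ℝ)^2 / (a:ℝ)^2) :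
    ∑ a ∈ U, f a ≤ 5 * C * S := by
  have hS' : (1:ℝ) ≤ S := by exact_mod_cast hS
  obtain ⟨M, hM⟩ : ∃ M : ℕ, ∀ a ∈ U, a.natAbs ≤ M :=
    ⟨U.sup Int.natAbs, fun a ha => Finset.le_sup (f := Int.natAbs) ha⟩
  have hsplit := Finset.sum_filter_add_sum_filter_not U (fun a : ℤ => a.natAbs ≤ S) f
  have hA : ∑ a ∈ U.filter (fun a : ℤ => a.natAbs ≤ S), f a ≤ (2 * S + 1) * C := by
    refine (Finset.sum_le_card_nsmul _ _ C fun b _ => h1 b).trans ?_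
    rw [nsmul_eq_mul]
    refine mul_le_mul_of_nonneg_right ?_ hC
    refine card_int_le _ 0 S (by positivity) fun b hb => ?_
    have := (Finset.mem_filter.1 hb).2
    rw [add_zero, ← Int.cast_abs, Int.abs_eq_natAbs]
    exact_mod_cast this
  have hB : ∑ a ∈ U.filter (fun a : ℤ => ¬ a.natAbs ≤ S), f a ≤ 2 * C * S := by
    have e1 : ∑ a ∈ U.filter (fun a : ℤ => ¬ a.natAbs ≤ S), f a ≤
        ∑ a ∈ U.filter (fun a : ℤ => ¬ a.natAbs ≤ S), C * (S:ℝ)^2 * ((a.natAbs : ℝ)^2)⁻¹ := by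
      refine Finset.sum_le_sum fun a ha => ?_
      have h := (Finset.mem_filter.1 ha).2
      refine (h2 a (by rintro rfl; simp at h)).trans_eq ?_
      rw [div_eq_mul_inv, Nat.cast_natAbs, Int.cast_abs, sq_abs]
    refine e1.trans ?_
    rw [← Finset.mul_sum]
    have e2 : ∑ a ∈ U.filter (fun a : ℤ => ¬ a.natAbs ≤ S), ((a.natAbs : ℝ)^2)⁻¹ ≤
        ∑ n ∈ Finset.Ioc S (max S M), 2 * ((n:ℝ)^2)⁻¹ := by
      rw [← Finset.sum_fiberwise_of_maps_to (g := Int.natAbs) (t := Finset.Ioc S (max S M))]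
      · refine Finset.sum_le_sum fun n hn => ?_
        have : ∑ a ∈ (U.filter (fun a : ℤ => ¬ a.natAbs ≤ S)).filter (fun a => a.natAbs = n),
            ((a.natAbs : ℝ)^2)⁻¹ ≤ ∑ a ∈ ({(n:ℤ), -(n:ℤ)} : Finset ℤ), ((n : ℝ)^2)⁻¹ := by
          have : ∑ a ∈ (U.filter (fun a : ℤ => ¬ a.natAbs ≤ S)).filter (fun a => a.natAbs = n),
            ((a.natAbs : ℝ)^2)⁻¹ = ∑ a ∈ (U.filter (fun a : ℤ => ¬ a.natAbs ≤ S)).filter (fun a => a.natAbs = n),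
            ((n : ℝ)^2)⁻¹ := Finset.sum_congr rfl fun a ha => by rw [(Finset.mem_filter.1 ha).2]
          rw [this]
          refine Finset.sum_le_sum_of_subset_of_nonneg ?_ fun _ _ _ => by positivity
          intro a ha
          have := (Finset.mem_filter.1 ha).2
          simp; omega
        refine this.trans ?_
        rw [Finset.sum_const, nsmul_eq_mul]
        refine mul_le_mul_of_nonneg_right ?_ (by positivity)
        exact_mod_cast Finset.card_le_two
      · intro a ha
        have h := (Finset.mem_filter.1 ha)
        have := hM a h.1
        rw [Finset.mem_Ioc]
        exact ⟨not_le.1 h.2, le_max_of_le_right this⟩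
    have e3 := sum_Ioc_inv_sq_le_sub (α := ℝ) (k := S) (n := max S M) (by omega) (le_max_left _ _)
    rw [← Finset.mul_sum] at e2
    have e4 : (0:ℝ) ≤ ((max S M : ℕ):ℝ)⁻¹ := by positivity
    have e5 : ∑ a ∈ U.filter (fun a : ℤ => ¬ a.natAbs ≤ S), ((a.natAbs : ℝ)^2)⁻¹ ≤ 2 * (S:ℝ)⁻¹ := by
      linarith
    refine (mul_le_mul_of_nonneg_left e5 (by positivity)).trans_eq ?_
    field_simp
  rw [← hsplit]
  nlinarith

lemma schur_row {χ χ1 χ2 : ℝ → ℝ} (hχ : Continuous χ) (hχ1 : Continuous χ1) (hχ2 : Continuous χ2)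
    (hd : ∀ x, HasDerivAt χ (χ1 x) x) (hd1 : ∀ x, HasDerivAt χ1 (χ2 x) x)
    (hc : HasCompactSupport χ) (hc1 : HasCompactSupport χ1) (hc2 : HasCompactSupport χ2) :
    ∃ C : ℝ, 0 ≤ C ∧ ∀ (S : ℕ), 1 ≤ S → ∀ V : Finset (ℤ × ℤ),
      ∑ q ∈ V, |∫ x, χ x * hlA ((S:ℝ)/5) ((q.2:ℝ) + (q.1:ℝ) * x)| ≤ C * S := by
  have hI : 0 ≤ ∫ v, hlF v := integral_nonneg hlF_nonneg
  have hI1 : 0 ≤ ∫ x, |χ x| := integral_nonneg fun _ => abs_nonneg _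
  have hI2 : 0 ≤ ∫ x, |χ2 x| := integral_nonneg fun _ => abs_nonneg _
  set C1 := (200 * ∫ v, hlF v) * ∫ x, |χ x| with hC1
  set C2 := (89 * 176 * (hlPhi 22)^2) * ∫ x, |χ2 x| with hC2
  have hC1' : 0 ≤ C1 := by positivity
  have hC2' : 0 ≤ C2 := by positivity
  refine ⟨5 * (C1 + C2), by positivity, fun S hS V => ?_⟩
  have hS' : (1:ℝ) ≤ S := by exact_mod_cast hS
  set M : ℤ → ℤ → ℝ := fun a b => |∫ x, χ x * hlA ((S:ℝ)/5) ((b:ℝ) + (a:ℝ) * x)| with hM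
  have hsub : V ⊆ V.image Prod.fst ×ˢ V.image Prod.snd := by
    intro q hq
    rw [Finset.mem_product]
    exact ⟨Finset.mem_image_of_mem _ hq, Finset.mem_image_of_mem _ hq⟩
  calc ∑ q ∈ V, M q.1 q.2 ≤ ∑ q ∈ V.image Prod.fst ×ˢ V.image Prod.snd, M q.1 q.2 :=
        Finset.sum_le_sum_of_subset_of_nonneg hsub fun _ _ _ => abs_nonneg _
    _ = ∑ a ∈ V.image Prod.fst, ∑ b ∈ V.image Prod.snd, M a b := Finset.sum_product _ _ _
    _ ≤ 5 * (C1 + C2) * S := by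
      refine sum_alpha S hS _ (C1 + C2) (by positivity)
        (fun a => ∑ b ∈ V.image Prod.snd, M a b) (fun a => ?_) (fun a ha => ?_)
      · have := sum_shift hχ hc (hlA_cont hS') _ (V.image Prod.snd)
          (fun t => hlA_sum hS' _ t) (a:ℝ)
        exact this.trans (by linarith)
      · have ha' : (a:ℝ) ≠ 0 := by exact_mod_cast ha
        have h := sum_shift hχ2 hc2 (hlB_cont hS') _ (V.image Prod.snd)
          (fun t => hlB_sum hS' _ t) (a:ℝ)
        have e : ∀ b : ℤ, M a b =
            ((a:ℝ)^2)⁻¹ * |∫ x, χ2 x * hlB ((S:ℝ)/5) ((b:ℝ) + (a:ℝ) * x)| := by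
          intro b
          simp only [hM]
          rw [ibp hχ hχ1 hd hc hc1 (hlA_cont hS') (hlA1_deriv hS') _ _ ha',
            ibp hχ1 hχ2 hd1 hc1 hc2 (hlA1_cont hS') (hlB_deriv hS') _ _ ha', ← mul_assoc, abs_mul]
          congr 1
          rw [neg_mul_neg, ← sq, inv_pow, abs_of_nonneg (by positivity)]
        simp only [e]
        rw [← Finset.mul_sum, div_eq_mul_inv, mul_comm]
        refine mul_le_mul_of_nonneg_right (h.trans ?_) (by positivity)
        have : 0 ≤ C1 * (S:ℝ)^2 := by positivity
        rw [add_mul]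
        have e2 : 89 * 176 * hlPhi 22 ^ 2 * (S:ℝ) ^ 2 * ∫ x, |χ2 x| = C2 * (S:ℝ)^2 := by
          rw [hC2]; ring
        linarith

/-- the normalised vertical offset from the core line of the tube -/
def hlu (t : ℤ × ℤ) (z : ℝ × ℝ) : ℝ := z.2 - t.2 - t.1 * z.1

lemma hlu_cont (t : ℤ × ℤ) : Continuous (hlu t) := by unfold hlu; fun_prop

lemma corr_eq (s x : ℝ) (t t' : ℤ × ℤ) :
    ∫ v, hlk s (hlu t (x, v)) * hlk s (hlu t' (x, v)) =
      hlA s (((t'.2 - t.2 : ℤ) : ℝ) + ((t'.1 - t.1 : ℤ) : ℝ) * x) := by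
  rw [hlA_eq]
  rw [← integral_add_right_eq_self (μ := volume) _ ((t.2:ℝ) + t.1 * x)]
  congr 1; ext v
  rw [← hlk_neg s (hlu t' _)]
  unfold hlu
  push_cast
  congr 2 <;> ring

lemma kk_cs {S : ℝ} (hS : 1 ≤ S) {χ : ℝ → ℝ} (h2 : ∀ x, 2 ≤ |x| → χ x = 0) (t t' : ℤ × ℤ) :
    HasCompactSupport fun z : ℝ × ℝ =>
      χ z.1 * (hlk (S/5) (hlu t z) * hlk (S/5) (hlu t' z)) := by
  set R : ℝ := 22 * S + |(t.2:ℝ)| + 2 * |(t.1:ℝ)| with hR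
  refine HasCompactSupport.intro (K := Icc (-2:ℝ) 2 ×ˢ Icc (-R) R)
    (isCompact_Icc.prod isCompact_Icc) fun z hz => ?_
  by_cases hx : 2 ≤ |z.1|
  · rw [h2 _ hx, zero_mul]
  · push Not at hx
    rw [hlk_zero hS (hlu t z), zero_mul, mul_zero]
    by_contra! h
    apply hz
    have hx' := abs_lt.1 hx
    have hb : |z.2| ≤ R := by
      have e : z.2 = hlu t z + (t.2 + t.1 * z.1) := by unfold hlu; ring
      rw [e]
      have a1 := abs_add_le (hlu t z) (t.2 + t.1 * z.1)
      have a2 := abs_add_le (t.2:ℝ) (t.1 * z.1)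
      have a3 : |(t.1:ℝ) * z.1| ≤ |(t.1:ℝ)| * 2 := by
        rw [abs_mul]; exact mul_le_mul_of_nonneg_left hx.le (abs_nonneg _)
      linarith
    exact ⟨⟨hx'.1.le, hx'.2.le⟩, abs_le.1 hb⟩

lemma kk_int {S : ℝ} (hS : 1 ≤ S) {χ : ℝ → ℝ} (hχ : Continuous χ)
    (h2 : ∀ x, 2 ≤ |x| → χ x = 0) (t t' : ℤ × ℤ) :
    Integrable fun z : ℝ × ℝ => χ z.1 * (hlk (S/5) (hlu t z) * hlk (S/5) (hlu t' z)) := by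
  apply Continuous.integrable_of_hasCompactSupport _ (kk_cs hS h2 t t')
  have := hlk_cont (S/5)
  have := hlu_cont t
  have := hlu_cont t'
  fun_prop

/-- the high-frequency part -/
def hlG (s : ℝ) (T : Finset (ℤ × ℤ)) (z : ℝ × ℝ) : ℝ := ∑ t ∈ T, hlk s (hlu t z)

lemma hlG_sq (s c : ℝ) (T : Finset (ℤ × ℤ)) (z : ℝ × ℝ) :
    c * (hlG s T z)^2 = ∑ t ∈ T, ∑ t' ∈ T, c * (hlk s (hlu t z) * hlk s (hlu t' z)) := by
  unfold hlG
  rw [sq, Finset.sum_mul_sum, Finset.mul_sum]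
  exact Finset.sum_congr rfl fun t _ => Finset.mul_sum _ _ _

lemma high_L2 : ∃ χ : ℝ → ℝ, ∃ C : ℝ, (∀ x, 0 ≤ χ x) ∧ (∀ x, |x| ≤ 1 → χ x = 1) ∧ 0 ≤ C ∧
    ∀ (S : ℕ), 1 ≤ S → ∀ T : Finset (ℤ × ℤ),
      Integrable (fun z : ℝ × ℝ => χ z.1 * (hlG ((S:ℝ)/5) T z)^2) ∧
      ∫ z : ℝ × ℝ, χ z.1 * (hlG ((S:ℝ)/5) T z)^2 ≤ C * S * T.card := by
  obtain ⟨χ, χ1, χ2, hχ, hχ1, hχ2, hd, hd1, h0, h1, h2, hc, hc1, hc2⟩ := exists_chi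
  obtain ⟨C, hC, hrow⟩ := schur_row hχ hχ1 hχ2 hd hd1 hc hc1 hc2
  refine ⟨χ, C, h0, h1, hC, fun S hS T => ?_⟩
  have hS' : (1:ℝ) ≤ S := by exact_mod_cast hS
  simp_rw [hlG_sq]
  have hint := fun t t' => kk_int hS' hχ h2 t t'
  refine ⟨integrable_finsetSum _ fun t _ => integrable_finsetSum _ fun t' _ => hint t t', ?_⟩
  rw [integral_finsetSum _ fun t _ => integrable_finsetSum _ fun t' _ => hint t t']
  have : ∀ t ∈ T, ∫ z : ℝ × ℝ, ∑ t' ∈ T, χ z.1 * (hlk ((S:ℝ)/5) (hlu t z) * hlk ((S:ℝ)/5) (hlu t' z))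
      ≤ C * S := by
    intro t _
    rw [integral_finsetSum _ fun t' _ => hint t t']
    refine le_trans ?_ (hrow S hS (T.image (fun t' => t' - t)))
    rw [Finset.sum_image (fun a _ b _ h => sub_left_injective h)]
    refine Finset.sum_le_sum fun t' _ => ?_
    refine le_trans (le_of_eq ?_) (le_abs_self _)
    rw [Measure.volume_eq_prod, integral_prod _ (hint t t')]
    congr 1; ext x
    simp only
    rw [integral_const_mul, corr_eq]
    rfl
  refine (Finset.sum_le_card_nsmul _ _ _ this).trans_eq ?_
  rw [nsmul_eq_mul]; ring

/-- incident squares have offset at most `21` -/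
lemma geo1 {δ : ℝ} (h0 : 0 < δ) (h1 : δ ≤ 1) {p t : ℤ × ℤ} (ht : tubeIdx δ t) (hp : sqInUnit δ p)
    (h : dSq δ p ⊆ nbTube 6 δ t) {z : ℝ × ℝ} (hz : (z.1, z.2 * δ) ∈ dSq δ p) :
    |hlu t z| ≤ 21 := by
  obtain ⟨⟨hx0, hx1⟩, -⟩ := hp hz
  have h3 := cthickening_subset_thickening' (E := dTube δ t) (δ₁ := 6 * δ) (δ₂ := 6.1 * δ)
    (by positivity) (by linarith) (h hz)
  rw [mem_thickening_iff] at h3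
  obtain ⟨⟨x', y'⟩, ⟨⟨a, b⟩, hab, hy⟩, hdist⟩ := h3
  rw [Prod.dist_eq, max_lt_iff, Real.dist_eq, Real.dist_eq] at hdist
  obtain ⟨⟨ha0, ha1⟩, ⟨hb0, hb1⟩⟩ := hab
  simp only at hx0 hx1 hy hdist ha0 ha1 hb0 hb1
  obtain ⟨ht0, ht1⟩ := ht
  have hX : |x'| ≤ 7.1 := by
    have := abs_lt.1 hdist.1
    rw [abs_le]; constructor <;> linarith
  have e : hlu t z * δ = (z.2 * δ - y') + (a - t.1 * δ) * x' + (b - t.2 * δ)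
      + (t.1 * δ) * (x' - z.1) := by
    rw [hy]; unfold hlu; ring
  have b1 : |(a - t.1 * δ) * x'| ≤ δ * 7.1 := by
    rw [abs_mul]
    refine mul_le_mul ?_ hX (abs_nonneg _) h0.le
    rw [abs_le]; constructor <;> linarith
  have b2 : |b - t.2 * δ| ≤ δ := by rw [abs_le]; constructor <;> linarith
  have b3 : |(t.1 * δ) * (x' - z.1)| ≤ 1 * (6.1 * δ) := by
    rw [abs_mul]
    refine mul_le_mul ?_ ?_ (abs_nonneg _) zero_le_one
    · rw [abs_le]; constructor <;> linarith
    · rw [abs_sub_comm]; exact hdist.1.le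
  have b4 : |hlu t z * δ| ≤ 21 * δ := by
    have c1 := abs_le.1 b1
    have c2 := abs_le.1 b2
    have c3 := abs_le.1 b3
    have c4 := abs_lt.1 hdist.2
    rw [e, abs_le]; constructor <;> linarith
  rw [abs_mul, abs_of_pos h0] at b4
  exact le_of_mul_le_mul_right b4 h0

lemma fdiv_bounds (a : ℤ) (S : ℕ) (hS : 1 ≤ S) :
    ((Int.fdiv a (S:ℤ) : ℤ) : ℝ) * S ≤ a ∧ (a:ℝ) + 1 ≤ ((Int.fdiv a (S:ℤ) : ℤ) + 1 : ℝ) * S := by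
  rw [Int.fdiv_eq_ediv_of_nonneg _ (by positivity)]
  have hS0 : (0:ℤ) < S := by exact_mod_cast hS
  have h1 := Int.ediv_mul_le a hS0.ne'
  have h2 := Int.lt_ediv_add_one_mul_self a hS0
  constructor
  · exact_mod_cast h1
  · exact_mod_cast h2

lemma geo_par {δ : ℝ} (h0 : 0 < δ) (S : ℕ) (hS : 1 ≤ S) (p : ℤ × ℤ) :
    dSq δ p ⊆ dSq ((S:ℝ) * δ) (parQ (S:ℤ) p) := by
  have key : ∀ a : ℤ, Ico ((a:ℝ) * δ) (((a:ℝ) + 1) * δ) ⊆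
      Ico (((Int.fdiv a (S:ℤ) : ℤ) : ℝ) * (S * δ)) ((((Int.fdiv a (S:ℤ) : ℤ) : ℝ) + 1) * (S * δ)) := by
    intro a
    obtain ⟨h1, h2⟩ := fdiv_bounds a S hS
    apply Ico_subset_Ico
    · rw [← mul_assoc]; exact mul_le_mul_of_nonneg_right h1 h0.le
    · rw [← mul_assoc]; exact mul_le_mul_of_nonneg_right h2 h0.le
  exact prod_mono (key _) (key _)

lemma geo2 {δ : ℝ} (h0 : 0 < δ) (S : ℕ) (hS : 1 ≤ S) {p t : ℤ × ℤ} {z : ℝ × ℝ}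
    (hz : (z.1, z.2 * δ) ∈ dSq δ p) (hu : |hlu t z| ≤ 5 * S) :
    dSq ((S:ℝ) * δ) (parQ (S:ℤ) p) ⊆ nbTube 6 ((S:ℝ) * δ) (parQ (S:ℤ) t) := by
  intro z' hz'
  obtain ⟨⟨hx0, hx1⟩, ⟨hy0, hy1⟩⟩ := geo_par h0 S hS p hz
  obtain ⟨⟨hx0', hx1'⟩, ⟨hy0', hy1'⟩⟩ := hz'
  simp only at hx0 hx1 hy0 hy1
  have hSd : 0 ≤ (S:ℝ) * δ := by positivity
  apply mem_cthickening_of_dist_le _ (z.1, (t.1 * δ) * z.1 + t.2 * δ)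
  · refine ⟨(t.1 * δ, t.2 * δ), geo_par h0 S hS t ?_, rfl⟩
    refine ⟨⟨le_rfl, ?_⟩, ⟨le_rfl, ?_⟩⟩ <;> simp only <;> linarith
  · rw [Prod.dist_eq, Real.dist_eq, Real.dist_eq]
    apply max_le
    · simp only; rw [abs_le]; constructor <;> linarith
    · simp only
      have e : z'.2 - ((t.1 * δ) * z.1 + t.2 * δ) = (z'.2 - z.2 * δ) + hlu t z * δ := by
        unfold hlu; ring
      have hu' := abs_le.1 hu
      have a1 : hlu t z * δ ≤ 5 * S * δ := mul_le_mul_of_nonneg_right hu'.2 h0.le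
      have a2 : -(5 * S) * δ ≤ hlu t z * δ := mul_le_mul_of_nonneg_right hu'.1 h0.le
      rw [e, abs_le]; constructor <;> linarith

/-- pointwise comparison -/
lemma pointwise {δ : ℝ} (h0 : 0 < δ) (h1 : δ ≤ 1) (S : ℕ) (hS : 1 ≤ S) {p t : ℤ × ℤ}
    (ht : tubeIdx δ t) (hp : sqInUnit δ p) {z : ℝ × ℝ} (hz : (z.1, z.2 * δ) ∈ dSq δ p) :
    (if dSq δ p ⊆ nbTube 6 δ t then (1:ℝ) else 0) -
      (5 / S) * (if dSq ((S:ℝ) * δ) (parQ (S:ℤ) p) ⊆ nbTube 6 ((S:ℝ) * δ) (parQ (S:ℤ) t)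
        then (1:ℝ) else 0) ≤ hlk ((S:ℝ)/5) (hlu t z) := by
  have hS' : (1:ℝ) ≤ S := by exact_mod_cast hS
  have hs : (0:ℝ) < (S:ℝ)/5 := by positivity
  unfold hlk
  apply sub_le_sub
  · split_ifs with h
    · rw [hlF_eq_one _ (geo1 h0 h1 ht hp h hz)]
    · exact hlF_nonneg _
  · rw [inv_div]
    refine mul_le_mul_of_nonneg_left ?_ (by positivity)
    split_ifs with h
    · exact hlF_le_one _
    · rw [hlF_eq_zero]
      by_contra! hlt
      apply h
      apply geo2 h0 S hS hz
      rw [abs_div, abs_of_pos hs, div_lt_iff₀ hs] at hlt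
      linarith

/-- rescaled cell -/
def hlQ (δ : ℝ) (p : ℤ × ℤ) : Set (ℝ × ℝ) :=
  Ico ((p.1:ℝ) * δ) (((p.1:ℝ) + 1) * δ) ×ˢ Ico (p.2:ℝ) ((p.2:ℝ) + 1)

lemma hlQ_mem {δ : ℝ} (h0 : 0 < δ) {p : ℤ × ℤ} {z : ℝ × ℝ} (hz : z ∈ hlQ δ p) :
    (z.1, z.2 * δ) ∈ dSq δ p :=
  ⟨hz.1, mul_le_mul_of_nonneg_right hz.2.1 h0.le, mul_lt_mul_of_pos_right hz.2.2 h0⟩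

lemma hlQ_meas (δ : ℝ) (p : ℤ × ℤ) : MeasurableSet (hlQ δ p) :=
  measurableSet_Ico.prod measurableSet_Ico

lemma hlQ_vol {δ : ℝ} (p : ℤ × ℤ) : volume (hlQ δ p) = ENNReal.ofReal δ := by
  unfold hlQ
  rw [Measure.volume_eq_prod, Measure.prod_prod, Real.volume_Ico, Real.volume_Ico]
  rw [add_sub_cancel_left, ENNReal.ofReal_one, mul_one]; congr 1; ring

lemma hlQ_disj {δ : ℝ} (h0 : 0 < δ) {p q : ℤ × ℤ} (h : p ≠ q) : Disjoint (hlQ δ p) (hlQ δ q) := by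
  rw [Set.disjoint_left]
  rintro z ⟨⟨a1, a2⟩, ⟨a3, a4⟩⟩ ⟨⟨b1, b2⟩, ⟨b3, b4⟩⟩
  apply h
  have c1 : (p.1:ℝ) < q.1 + 1 := lt_of_mul_lt_mul_right (a1.trans_lt b2) h0.le
  have c2 : (q.1:ℝ) < p.1 + 1 := lt_of_mul_lt_mul_right (b1.trans_lt a2) h0.le
  have c3 : (p.2:ℝ) < q.2 + 1 := a3.trans_lt b4
  have c4 : (q.2:ℝ) < p.2 + 1 := b3.trans_lt a4
  have d1 : p.1 < q.1 + 1 := by exact_mod_cast c1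
  have d2 : q.1 < p.1 + 1 := by exact_mod_cast c2
  have d3 : p.2 < q.2 + 1 := by exact_mod_cast c3
  have d4 : q.2 < p.2 + 1 := by exact_mod_cast c4
  exact Prod.ext (by omega) (by omega)

lemma high_low_core : ∃ C : ℝ, 0 ≤ C ∧ ∀ (δ : ℝ), 0 < δ → δ ≤ 1 → ∀ (S : ℕ), 1 ≤ S →
    ∀ (P T : Finset (ℤ × ℤ)) (w : ℤ × ℤ → ℝ),
      (∀ p ∈ P, sqInUnit δ p) → (∀ p, 0 ≤ w p) → (∀ t ∈ T, tubeIdx δ t) →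
      incW δ δ id P T w ≤ Real.sqrt (C * (S * δ⁻¹ * T.card * ∑ p ∈ P, (w p)^2)) +
        (5 / S) * incW δ ((S:ℝ) * δ) (parQ (S:ℤ)) P T w := by
  obtain ⟨χ, C, hχ0, hχ1, hC, hL2⟩ := high_L2
  refine ⟨C, hC, fun δ h0 h1 S hS P T w hP hw hT => ?_⟩
  obtain ⟨hint, hbd⟩ := hL2 S hS T
  set c : ℤ × ℤ → ℝ := fun p => ∑ t ∈ T, ((if dSq δ p ⊆ nbTube 6 δ t then (1:ℝ) else 0) -
      (5 / S) * (if dSq ((S:ℝ) * δ) (parQ (S:ℤ) p) ⊆ nbTube 6 ((S:ℝ) * δ) (parQ (S:ℤ) t)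
        then (1:ℝ) else 0)) with hcdef
  have hsplit : incW δ δ id P T w - (5 / S) * incW δ ((S:ℝ) * δ) (parQ (S:ℤ)) P T w =
      ∑ p ∈ P, w p * c p := by
    unfold incW
    rw [Finset.mul_sum, ← Finset.sum_sub_distrib]
    refine Finset.sum_congr rfl fun p _ => ?_
    rw [Finset.mul_sum, ← Finset.sum_sub_distrib, hcdef, Finset.mul_sum]
    refine Finset.sum_congr rfl fun t _ => ?_
    simp only [id]
    split_ifs <;> ring
  have hc : ∀ p ∈ P, ∀ z ∈ hlQ δ p, c p ≤ hlG ((S:ℝ)/5) T z := fun p hp z hz =>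
    Finset.sum_le_sum fun t ht => pointwise h0 h1 S hS (hT t ht) (hP p hp) (hlQ_mem h0 hz)
  have hsq : δ * ∑ p ∈ P, (max (c p) 0)^2 ≤ C * S * T.card := by
    refine le_trans ?_ hbd
    have hvol : ∀ p, volume (hlQ δ p) ≠ ⊤ := fun p => by rw [hlQ_vol]; exact ENNReal.ofReal_ne_top
    calc δ * ∑ p ∈ P, (max (c p) 0)^2 = ∑ p ∈ P, ∫ z in hlQ δ p, (max (c p) 0)^2 := by
          rw [Finset.mul_sum]
          refine Finset.sum_congr rfl fun p _ => ?_
          rw [setIntegral_const, Measure.real, hlQ_vol, ENNReal.toReal_ofReal h0.le, smul_eq_mul]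
      _ ≤ ∑ p ∈ P, ∫ z in hlQ δ p, χ z.1 * (hlG ((S:ℝ)/5) T z)^2 := by
          refine Finset.sum_le_sum fun p hp => ?_
          refine setIntegral_mono_on (integrableOn_const (hvol p)) hint.integrableOn (hlQ_meas δ p)
            fun z hz => ?_
          obtain ⟨⟨hx0, hx1⟩, -⟩ := hP p hp (hlQ_mem h0 hz)
          rw [hχ1 z.1 (by rw [abs_of_nonneg hx0]; exact le_of_lt hx1), one_mul]
          rcases le_total (c p) 0 with h | h
          · rw [max_eq_right h, zero_pow two_ne_zero]; exact sq_nonneg _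
          · rw [max_eq_left h]; exact pow_le_pow_left₀ h (hc p hp z hz) 2
      _ = ∫ z in ⋃ p ∈ P, hlQ δ p, χ z.1 * (hlG ((S:ℝ)/5) T z)^2 := by
          rw [integral_biUnion_finset]
          · intro p _; exact hlQ_meas δ p
          · intro p _ q _ hpq; exact hlQ_disj h0 hpq
          · intro p _; exact hint.integrableOn
      _ ≤ _ := setIntegral_le_integral hint
          (Filter.Eventually.of_forall fun z => mul_nonneg (hχ0 _) (sq_nonneg _))
  have hfin : ∑ p ∈ P, w p * c p ≤ Real.sqrt (C * (S * δ⁻¹ * T.card * ∑ p ∈ P, (w p)^2)) := by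
    calc _ ≤ ∑ p ∈ P, w p * max (c p) 0 :=
          Finset.sum_le_sum fun p _ => mul_le_mul_of_nonneg_left (le_max_left _ _) (hw p)
      _ ≤ _ := by
          refine Real.le_sqrt_of_sq_le ?_
          refine (Finset.sum_mul_sq_le_sq_mul_sq _ _ _).trans ?_
          have h3 : ∑ p ∈ P, (max (c p) 0)^2 ≤ C * S * T.card * δ⁻¹ := by
            rw [← div_eq_mul_inv, le_div_iff₀ h0]; linarith
          have := mul_le_mul_of_nonneg_left h3 (Finset.sum_nonneg (s := P) fun p _ => sq_nonneg (w p))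
          refine this.trans_eq ?_
          ring
  linarith


end HighLowAux

/-- **High–low incidence estimate.** For a set `𝒫` of distinct weighted dyadic
`δ`-squares in `[0,1)²` with weights `w ≥ 0`, a set `𝒯` of distinct dyadic
`δ`-tubes and any `S = 2^k` with `δ^{−ε/100} ≤ S ≤ δ^{−1}`:
`I_w(𝒫,𝒯) ≲_ε (S δ^{−1} |𝒯| Σ_p w(p)²)^{1/2} + S^{−1+ε} I_w(𝒫, 𝒯^{Sδ})`. -/
theorem high_low_incidence (ε : ℝ) (hε : 0 < ε) :
    ∃ Cε > (0 : ℝ), ∀ (n k : ℕ) (δ : ℝ), δ = 2 ^ (-(n : ℤ)) →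
      δ ^ (-(ε / 100)) ≤ (2 : ℝ) ^ k → ((2 : ℝ) ^ k) ≤ δ⁻¹ →
      ∀ (P T : Finset (ℤ × ℤ)) (w : ℤ × ℤ → ℝ),
        (∀ p ∈ P, sqInUnit δ p) → (∀ p, 0 ≤ w p) → (∀ t ∈ T, tubeIdx δ t) →
        incW δ δ id P T w ≤
          Cε * ((((2 : ℝ) ^ k) * δ⁻¹ * (T.card : ℝ) * ∑ p ∈ P, (w p) ^ 2) ^ ((1 : ℝ) / 2)
            + ((2 : ℝ) ^ k) ^ (-1 + ε) *
                incW δ (((2 : ℝ) ^ k) * δ) (parQ ((2 : ℤ) ^ k)) P T w) := by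
  obtain ⟨C, hC, hcore⟩ := high_low_core
  refine ⟨Real.sqrt C + 5, add_pos_of_nonneg_of_pos (Real.sqrt_nonneg C) (by norm_num), ?_⟩
  intro n k δ hδ _ _ P T w hP hw hT
  have h0 : 0 < δ := by rw [hδ]; positivity
  have h1 : δ ≤ 1 := by
    rw [hδ, zpow_neg, zpow_natCast]
    exact inv_le_one_of_one_le₀ (one_le_pow₀ (by norm_num))
  have h := hcore δ h0 h1 (2^k) Nat.one_le_two_pow P T w hP hw hT
  push_cast at h
  rw [Real.sqrt_mul hC, Real.sqrt_eq_rpow (_ * _)] at h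
  set X := (((2 : ℝ) ^ k) * δ⁻¹ * (T.card : ℝ) * ∑ p ∈ P, (w p) ^ 2) ^ ((1 : ℝ) / 2) with hX
  set Y := incW δ (((2 : ℝ) ^ k) * δ) (parQ ((2 : ℤ) ^ k)) P T w with hY
  have hX0 : 0 ≤ X := by
    apply Real.rpow_nonneg
    have := Finset.sum_nonneg (s := P) fun p _ => sq_nonneg (w p)
    positivity
  have hY0 : 0 ≤ Y := by
    refine Finset.sum_nonneg fun p _ => Finset.sum_nonneg fun t _ => ?_
    split_ifs
    · exact hw p
    · exact le_rfl
  have hS1 : (1:ℝ) ≤ 2^k := one_le_pow₀ (by norm_num)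
  have hpow : ((2:ℝ)^k)⁻¹ ≤ ((2:ℝ)^k) ^ (-1 + ε) := by
    rw [← Real.rpow_neg_one]
    exact Real.rpow_le_rpow_of_exponent_le hS1 (by linarith)
  have hZ : 5 / (2:ℝ)^k * Y ≤ 5 * (((2:ℝ)^k) ^ (-1 + ε) * Y) := by
    rw [div_eq_mul_inv, mul_assoc]
    exact mul_le_mul_of_nonneg_left (mul_le_mul_of_nonneg_right hpow hY0) (by norm_num)
  have hW0 : 0 ≤ ((2:ℝ)^k) ^ (-1 + ε) * Y := mul_nonneg (Real.rpow_nonneg (by positivity) _) hY0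
  have hq : 0 ≤ Real.sqrt C := Real.sqrt_nonneg C
  have p1 := mul_nonneg hq hW0
  calc _ ≤ Real.sqrt C * X + 5 / (2:ℝ)^k * Y := h
    _ ≤ _ := by nlinarith

end
end

section
/- Fix Δ < Δ₀ (Δ₀ ∈ (0,1) an absolute constant), n ∈ ℕ, and δ = Δⁿ. Let (𝒫₀, 𝒯₀) be a (δ, s, C₀, M₀)-nice configuration with 𝒫₀ a (δ, t, C₀)-set and s + t ≥ 2. Then there exists a refinement (𝒫, 𝒯) of (𝒫₀, 𝒯₀) such that for any 1 ≤ k ≤ n, any T ∈ 𝒯, w = Δ^k, and ε ∈ (0, 1/n], one has |6(T^w) ∩ 𝒟_w(𝒫)| ≤ C_ε (log(1/δ))^C · C₀² Δ^{−1} · |𝒫|_w · w^{1−ε}, where |6(T^w) ∩ 𝒟_w(𝒫)| counts the dyadic w-squares of 𝒟_w(𝒫) contained in the 6w-neighborhood of T^w, and the constants C, C_ε may depend on Δ₀, n (and C_ε on ε) but not on Δ, C₀, M₀. -/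
open Set Metric
open scoped Classical

noncomputable section

/-- `(P, Tp)` is a refinement of the configuration `(P₀, T₀p)` (with `|𝒯₀(p)| ∼ M₀`),
with all the implicit `≈_δ` factors bounded by `K (log 1/δ)^K`. -/
def IsRefinementC (K δ M0 : ℝ) (P0 : Finset (ℤ × ℤ)) (T0p : ℤ × ℤ → Finset (ℤ × ℤ))
    (P : Finset (ℤ × ℤ)) (Tp : ℤ × ℤ → Finset (ℤ × ℤ)) : Prop :=
  P ⊆ P0 ∧ (P0.card : ℝ) ≤ K * (Real.log δ⁻¹) ^ K * (P.card : ℝ) ∧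
  (∀ p ∈ P, Tp p ⊆ T0p p) ∧
  (P0.card : ℝ) * M0 ≤ K * (Real.log δ⁻¹) ^ K * ∑ p ∈ P, ((Tp p).card : ℝ)

/-! ### Analytic part -/

/-- normalised box of half-width `34 r`. -/
def hlBox (r v : ℝ) : ℝ := if |v| ≤ 34 * r then 1 / (68 * r) else 0

/-- Lipschitz cutoff. -/
def hlChi (x : ℝ) : ℝ := max 0 (2 - |x - 1|)

/-- mean zero profile. -/
def hlPsi (w w' v : ℝ) : ℝ := hlBox w v - hlBox w' v

lemma hlBox_nonneg {r : ℝ} (hr : 0 < r) (v : ℝ) : 0 ≤ hlBox r v := by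
  unfold hlBox; split_ifs <;> positivity

lemma hlBox_le {r : ℝ} (hr : 0 < r) (v : ℝ) : hlBox r v ≤ 1 / (68 * r) := by
  unfold hlBox; split_ifs
  · exact le_rfl
  · positivity

lemma hlBox_meas (r : ℝ) : Measurable (hlBox r) := by
  unfold hlBox
  exact Measurable.ite (measurableSet_le (by fun_prop) measurable_const) measurable_const
    measurable_const

lemma hlChi_meas : Measurable hlChi := by
  unfold hlChi; fun_prop

lemma hlPsi_meas (w w' : ℝ) : Measurable (hlPsi w w') := by
  unfold hlPsi; exact (hlBox_meas w).sub (hlBox_meas w')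

lemma hlChi_nonneg (x : ℝ) : 0 ≤ hlChi x := le_max_left _ _

lemma hlChi_le (x : ℝ) : hlChi x ≤ 2 := by
  unfold hlChi; exact max_le (by norm_num) (by linarith [abs_nonneg (x - 1)])

lemma hlChi_supp {x : ℝ} (h : hlChi x ≠ 0) : -1 ≤ x ∧ x ≤ 3 := by
  unfold hlChi at h
  by_contra hx
  apply h
  apply max_eq_left
  by_contra h2
  push Not at h2
  have : |x - 1| < 2 := by linarith
  rw [abs_lt] at this
  exact hx ⟨by linarith, by linarith⟩

lemma hlChi_ge {x : ℝ} (h0 : 0 ≤ x) (h2 : x ≤ 2) : 1 ≤ hlChi x := by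
  unfold hlChi
  apply le_max_of_le_right
  have : |x - 1| ≤ 1 := abs_le.2 ⟨by linarith, by linarith⟩
  linarith

lemma hlChi_lip (x y : ℝ) : |hlChi x - hlChi y| ≤ |x - y| := by
  unfold hlChi
  have h1 : |max 0 (2 - |x - 1|) - max 0 (2 - |y - 1|)| ≤ |(2 - |x - 1|) - (2 - |y - 1|)| := by
    have := abs_max_sub_max_le_abs (2 - |x - 1|) (2 - |y - 1|) 0
    rwa [max_comm, max_comm 0 (2 - |y - 1|)]
  refine h1.trans ?_
  have h2 : (2 - |x - 1|) - (2 - |y - 1|) = |y - 1| - |x - 1| := by ring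
  rw [h2]
  refine (abs_abs_sub_abs_le _ _).trans ?_
  rw [abs_sub_comm x y]
  apply le_of_eq; congr 1; ring

lemma hl_integrable1 {g : ℝ → ℝ} (hm : Measurable g) {C L : ℝ} (hC : ∀ x, |g x| ≤ C)
    (hs : ∀ x, g x ≠ 0 → |x| ≤ L) : MeasureTheory.Integrable g := by
  have hsub : Function.support g ⊆ Set.Icc (-L) L := by
    intro x hx
    exact abs_le.1 (hs x hx)
  rw [← MeasureTheory.integrableOn_iff_integrable_of_support_subset hsub]
  exact MeasureTheory.Measure.integrableOn_of_bounded (M := C)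
    (isCompact_Icc.measure_lt_top.ne) hm.aestronglyMeasurable
    (Filter.Eventually.of_forall fun x => by simpa using hC x)

lemma hl_integrable2 {g : ℝ × ℝ → ℝ} (hm : Measurable g) {C L : ℝ} (hC : ∀ x, |g x| ≤ C)
    (hs : ∀ x, g x ≠ 0 → |x.1| ≤ L ∧ |x.2| ≤ L) : MeasureTheory.Integrable g := by
  have hsub : Function.support g ⊆ Set.Icc (-L) L ×ˢ Set.Icc (-L) L := by
    intro x hx
    exact ⟨abs_le.1 (hs x hx).1, abs_le.1 (hs x hx).2⟩
  rw [← MeasureTheory.integrableOn_iff_integrable_of_support_subset hsub]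
  exact MeasureTheory.Measure.integrableOn_of_bounded (M := C)
    ((isCompact_Icc.prod isCompact_Icc).measure_lt_top.ne) hm.aestronglyMeasurable
    (Filter.Eventually.of_forall fun x => by simpa using hC x)

lemma hlBox_eq (r : ℝ) : hlBox r = (Set.Icc (-(34 * r)) (34 * r)).indicator
    (fun _ => 1 / (68 * r)) := by
  funext v
  unfold hlBox Set.indicator
  simp only [Set.mem_Icc, abs_le]

lemma hlBox_int {r : ℝ} (hr : 0 < r) : ∫ v, hlBox r v = 1 := by
  rw [hlBox_eq, MeasureTheory.integral_indicator_const _ measurableSet_Icc]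
  rw [Real.volume_real_Icc_of_le (by linarith)]
  simp only [smul_eq_mul]
  field_simp
  ring

lemma hlBox_integrable {r : ℝ} (hr : 0 < r) : MeasureTheory.Integrable (hlBox r) := by
  apply hl_integrable1 (hlBox_meas r) (C := 1 / (68 * r)) (L := 34 * r)
  · intro x; rw [abs_of_nonneg (hlBox_nonneg hr x)]; exact hlBox_le hr x
  · intro x hx; unfold hlBox at hx; by_contra h; simp [h] at hx

lemma hlPsi_abs_le {w w' : ℝ} (hw : 0 < w) (hww : w ≤ w') (v : ℝ) :
    |hlPsi w w' v| ≤ 1 / (68 * w) := by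
  have hw' : 0 < w' := hw.trans_le hww
  have h1 := hlBox_nonneg hw v
  have h2 := hlBox_le hw v
  have h3 := hlBox_nonneg hw' v
  have h4 := hlBox_le hw' v
  have h5 : 1 / (68 * w') ≤ 1 / (68 * w) := by gcongr
  unfold hlPsi
  exact abs_le.2 ⟨by linarith, by linarith⟩

lemma hlPsi_supp {w w' : ℝ} (hww : w ≤ w') {v : ℝ} (h : hlPsi w w' v ≠ 0) :
    |v| ≤ 34 * w' := by
  by_contra hv
  apply h
  unfold hlPsi hlBox
  rw [if_neg (by intro h2; apply hv; linarith), if_neg hv]; simp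

lemma hlPsi_integrable {w w' : ℝ} (hw : 0 < w) (hww : w ≤ w') :
    MeasureTheory.Integrable (hlPsi w w') :=
  (hlBox_integrable hw).sub (hlBox_integrable (hw.trans_le hww))

lemma hlPsi_int_abs {w w' : ℝ} (hw : 0 < w) (hww : w ≤ w') :
    ∫ v, |hlPsi w w' v| ≤ 2 := by
  have hw' : 0 < w' := hw.trans_le hww
  calc ∫ v, |hlPsi w w' v| ≤ ∫ v, (hlBox w v + hlBox w' v) := by
        apply MeasureTheory.integral_mono (hlPsi_integrable hw hww).abs
          ((hlBox_integrable hw).add (hlBox_integrable hw'))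
        intro v
        have h1 := hlBox_nonneg hw v
        have h3 := hlBox_nonneg hw' v
        change |hlBox w v - hlBox w' v| ≤ hlBox w v + hlBox w' v
        exact abs_le.2 ⟨by linarith, by linarith⟩
    _ = 2 := by
        rw [MeasureTheory.integral_add (hlBox_integrable hw) (hlBox_integrable hw'),
          hlBox_int hw, hlBox_int hw']; norm_num

/-- average of the cutoff. -/
lemma hl_avg {r α u : ℝ} (hr : 0 < r) (hα : α ≠ 0) :
    |(∫ x, hlChi x * hlBox r (u + α * x)) - |α⁻¹| * hlChi (-u / α)| ≤ 34 * r / α ^ 2 := by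
  have h1 : (∫ x, hlChi x * hlBox r (u + α * x))
      = |α⁻¹| * ∫ v, hlChi ((v - u) / α) * hlBox r v := by
    have := MeasureTheory.Measure.integral_comp_mul_left
      (fun y => hlChi (y / α) * hlBox r (u + y)) α
    simp only [smul_eq_mul] at this
    have e : (fun x => hlChi x * hlBox r (u + α * x))
        = fun x => hlChi (α * x / α) * hlBox r (u + α * x) := by
      funext x; rw [mul_div_cancel_left₀ _ hα]
    rw [e, this]
    congr 1
    rw [← MeasureTheory.integral_sub_right_eq_self _ u]
    apply MeasureTheory.integral_congr_ae
    refine Filter.Eventually.of_forall fun v => ?_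
    simp only [add_sub_cancel]
  have hInt1 : MeasureTheory.Integrable (fun v => hlChi ((v - u) / α) * hlBox r v) := by
    apply hl_integrable1 (C := 2 * (1 / (68 * r))) (L := 34 * r)
    · exact (hlChi_meas.comp (by fun_prop)).mul (hlBox_meas r)
    · intro x
      rw [abs_mul, abs_of_nonneg (hlBox_nonneg hr x), abs_of_nonneg (hlChi_nonneg _)]
      exact mul_le_mul (hlChi_le _) (hlBox_le hr x) (hlBox_nonneg hr x) (by norm_num)
    · intro x hx; by_contra h; apply hx; simp [hlBox, h]
  have h2 : (∫ v, hlChi ((v - u) / α) * hlBox r v) - hlChi (-u / α)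
      = ∫ v, (hlChi ((v - u) / α) * hlBox r v - hlChi (-u / α) * hlBox r v) := by
    rw [MeasureTheory.integral_sub hInt1 ((hlBox_integrable hr).const_mul _),
      MeasureTheory.integral_const_mul, hlBox_int hr, mul_one]
  have h3 : |(∫ v, hlChi ((v - u) / α) * hlBox r v) - hlChi (-u / α)| ≤ 34 * r / |α| := by
    rw [h2, ← Real.norm_eq_abs]
    have := MeasureTheory.norm_integral_le_of_norm_le
      (f := fun v => (hlChi ((v - u) / α) * hlBox r v - hlChi (-u / α) * hlBox r v))
      (g := fun v => 34 * r / |α| * hlBox r v) ((hlBox_integrable hr).const_mul _)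
      (Filter.Eventually.of_forall ?_)
    · refine this.trans (le_of_eq ?_)
      rw [MeasureTheory.integral_const_mul, hlBox_int hr, mul_one]
    · intro v
      rw [← sub_mul, Real.norm_eq_abs, abs_mul, abs_of_nonneg (hlBox_nonneg hr v)]
      by_cases hv : |v| ≤ 34 * r
      · apply mul_le_mul_of_nonneg_right _ (hlBox_nonneg hr v)
        refine (hlChi_lip _ _).trans ?_
        have : (v - u) / α - -u / α = v / α := by ring
        rw [this, abs_div]
        gcongr
      · simp [hlBox, hv]
  rw [h1, ← mul_sub, abs_mul, abs_abs]
  calc |α⁻¹| * _ ≤ |α⁻¹| * (34 * r / |α|) := by gcongr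
    _ = 34 * r / α ^ 2 := by rw [abs_inv, ← sq_abs]; field_simp

lemma hl_G_int {w w' α u : ℝ} (hw : 0 < w) (hww : w ≤ w') :
    MeasureTheory.Integrable (fun x => hlChi x * hlPsi w w' (u + α * x)) := by
  apply hl_integrable1 (C := 2 * (1 / (68 * w))) (L := 3)
  · exact hlChi_meas.mul ((hlPsi_meas w w').comp (by fun_prop))
  · intro x
    rw [abs_mul, abs_of_nonneg (hlChi_nonneg _)]
    exact mul_le_mul (hlChi_le _) (hlPsi_abs_le hw hww _) (abs_nonneg _) (by norm_num)
  · intro x hx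
    have := hlChi_supp (left_ne_zero_of_mul hx)
    exact abs_le.2 ⟨by linarith, by linarith⟩

lemma hl_G_far {w w' α u : ℝ} (hw : 0 < w) (hww : w ≤ w') (hα : α ≠ 0) :
    |∫ x, hlChi x * hlPsi w w' (u + α * x)| ≤ 68 * w' / α ^ 2 := by
  have hw' : 0 < w' := hw.trans_le hww
  have hi : ∀ r, 0 < r → MeasureTheory.Integrable (fun x => hlChi x * hlBox r (u + α * x)) := by
    intro r hr
    apply hl_integrable1 (C := 2 * (1 / (68 * r))) (L := 3)
    · exact hlChi_meas.mul ((hlBox_meas r).comp (by fun_prop))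
    · intro x
      rw [abs_mul, abs_of_nonneg (hlChi_nonneg _), abs_of_nonneg (hlBox_nonneg hr _)]
      exact mul_le_mul (hlChi_le _) (hlBox_le hr _) (hlBox_nonneg hr _) (by norm_num)
    · intro x hx
      have := hlChi_supp (left_ne_zero_of_mul hx)
      exact abs_le.2 ⟨by linarith, by linarith⟩
  have e : (∫ x, hlChi x * hlPsi w w' (u + α * x))
      = (∫ x, hlChi x * hlBox w (u + α * x)) - ∫ x, hlChi x * hlBox w' (u + α * x) := by
    rw [← MeasureTheory.integral_sub (hi w hw) (hi w' hw')]
    simp only [hlPsi, mul_sub]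
  rw [e]
  have h1 := abs_le.1 (hl_avg (u := u) hw hα)
  have h2 := abs_le.1 (hl_avg (u := u) hw' hα)
  have h3 : 34 * w / α ^ 2 ≤ 34 * w' / α ^ 2 := by gcongr
  have h4 : 68 * w' / α ^ 2 = 34 * w' / α ^ 2 + 34 * w' / α ^ 2 := by ring
  rw [h4]
  exact abs_le.2 ⟨by linarith [h1.1, h2.2], by linarith [h1.2, h2.1]⟩

lemma hl_G_near {w w' α u : ℝ} (hw : 0 < w) (hww : w ≤ w') :
    |∫ x, hlChi x * hlPsi w w' (u + α * x)| ≤ 1 / w := by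
  have := MeasureTheory.norm_integral_le_of_norm_le (μ := MeasureTheory.volume)
    (f := fun x => hlChi x * hlPsi w w' (u + α * x))
    (g := (Set.Icc (-1 : ℝ) 3).indicator (fun _ => 2 * (1 / (68 * w)))) ?_
    (Filter.Eventually.of_forall ?_)
  · rw [MeasureTheory.integral_indicator_const _ measurableSet_Icc,
      Real.volume_real_Icc_of_le (by norm_num)] at this
    rw [← Real.norm_eq_abs]
    refine this.trans ?_
    rw [smul_eq_mul, show ((3 : ℝ) - -1) * (2 * (1 / (68 * w))) = (8 / 68) * (1 / w) by
      field_simp; norm_num]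
    have : 0 < 1 / w := by positivity
    linarith
  · rw [MeasureTheory.integrable_indicator_iff measurableSet_Icc]
    exact MeasureTheory.integrableOn_const (isCompact_Icc.measure_lt_top.ne)
  · intro x
    rw [Real.norm_eq_abs, abs_mul, abs_of_nonneg (hlChi_nonneg _)]
    by_cases hx : x ∈ Set.Icc (-1 : ℝ) 3
    · rw [Set.indicator_of_mem hx]
      exact mul_le_mul (hlChi_le _) (hlPsi_abs_le hw hww _) (abs_nonneg _) (by norm_num)
    · rw [Set.indicator_of_notMem hx]
      have : hlChi x = 0 := by
        by_contra h
        exact hx (hlChi_supp h)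
      simp [this]

/-- the interaction of two lines -/
def hlH (w w' a b a' b' : ℝ) : ℝ :=
  ∫ z : ℝ × ℝ, hlChi z.1 * (hlPsi w w' (z.2 - a * z.1 - b) * hlPsi w w' (z.2 - a' * z.1 - b'))

lemma hlH_integrable {w w' : ℝ} (a b a' b' : ℝ) (hw : 0 < w) (hww : w ≤ w') :
    MeasureTheory.Integrable (fun z : ℝ × ℝ => hlChi z.1 *
      (hlPsi w w' (z.2 - a * z.1 - b) * hlPsi w w' (z.2 - a' * z.1 - b'))) := by
  have hw' : 0 < w' := hw.trans_le hww
  apply hl_integrable2 (C := 2 * (1 / (68 * w) * (1 / (68 * w))))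
    (L := 34 * w' + 3 * |a| + |b| + 3)
  · refine (hlChi_meas.comp measurable_fst).mul (((hlPsi_meas w w').comp ?_).mul
      ((hlPsi_meas w w').comp ?_)) <;> fun_prop
  · intro z
    rw [abs_mul, abs_of_nonneg (hlChi_nonneg _), abs_mul]
    have h1 := hlPsi_abs_le hw hww (z.2 - a * z.1 - b)
    have h2 := hlPsi_abs_le hw hww (z.2 - a' * z.1 - b')
    have := hlChi_le z.1
    gcongr
  · intro z hz
    have h1 := hlChi_supp (left_ne_zero_of_mul hz)
    have h2 := hlPsi_supp hww (left_ne_zero_of_mul (right_ne_zero_of_mul hz))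
    have h3 : |z.1| ≤ 3 := abs_le.2 ⟨by linarith, by linarith⟩
    refine ⟨?_, ?_⟩
    · have := abs_nonneg a; have := abs_nonneg b; linarith
    · have e : z.2 = (z.2 - a * z.1 - b) + a * z.1 + b := by ring
      have h4 : |a * z.1| ≤ |a| * 3 := by rw [abs_mul]; gcongr
      have h5 := abs_add_le ((z.2 - a * z.1 - b) + a * z.1) b
      have h6 := abs_add_le (z.2 - a * z.1 - b) (a * z.1)
      rw [← e] at h5
      linarith

lemma hlH_eq {w w' : ℝ} (a b a' b' : ℝ) (hw : 0 < w) (hww : w ≤ w') :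
    hlH w w' a b a' b' = ∫ u, hlPsi w w' u *
      ∫ x, hlChi x * hlPsi w w' ((u + (b - b')) + (a - a') * x) := by
  have hw' : 0 < w' := hw.trans_le hww
  unfold hlH
  have hi := hlH_integrable a b a' b' hw hww
  rw [MeasureTheory.Measure.volume_eq_prod] at hi ⊢
  rw [MeasureTheory.integral_prod _ hi]
  have e1 : ∀ x : ℝ, (∫ y : ℝ, hlChi x * (hlPsi w w' (y - a * x - b) *
        hlPsi w w' (y - a' * x - b')))
      = ∫ u : ℝ, hlPsi w w' u * (hlChi x * hlPsi w w' ((u + (b - b')) + (a - a') * x)) := by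
    intro x
    rw [← MeasureTheory.integral_sub_right_eq_self
      (fun u => hlPsi w w' u * (hlChi x * hlPsi w w' ((u + (b - b')) + (a - a') * x)))
      (a * x + b)]
    apply MeasureTheory.integral_congr_ae
    refine Filter.Eventually.of_forall fun y => ?_
    simp only
    rw [show y - (a * x + b) = y - a * x - b by ring,
      show y - a * x - b + (b - b') + (a - a') * x = y - a' * x - b' by ring]
    ring
  simp only [e1]
  rw [MeasureTheory.integral_integral_swap]
  · simp only [MeasureTheory.integral_const_mul]
  · rw [← MeasureTheory.Measure.volume_eq_prod]
    apply hl_integrable2 (C := 1 / (68 * w) * (2 * (1 / (68 * w)))) (L := 34 * w' + 3)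
    · refine ((hlPsi_meas w w').comp measurable_snd).mul ((hlChi_meas.comp measurable_fst).mul
        ((hlPsi_meas w w').comp ?_))
      fun_prop
    · rintro ⟨x, u⟩
      simp only [Function.uncurry]
      rw [abs_mul, abs_mul, abs_of_nonneg (hlChi_nonneg _)]
      have h1 := hlPsi_abs_le hw hww u
      have h2 := hlPsi_abs_le hw hww ((u + (b - b')) + (a - a') * x)
      have := hlChi_le x
      have := hlChi_nonneg x
      gcongr
    · rintro ⟨x, u⟩ hz
      simp only [Function.uncurry] at hz ⊢
      have h1 := hlChi_supp (left_ne_zero_of_mul (right_ne_zero_of_mul hz))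
      have h2 := hlPsi_supp hww (left_ne_zero_of_mul hz)
      exact ⟨abs_le.2 ⟨by linarith, by linarith⟩, by linarith⟩

lemma hlH_le_of {w w' a b a' b' K : ℝ} (hw : 0 < w) (hww : w ≤ w')
    (h : ∀ u, |u| ≤ 34 * w' →
      |∫ x, hlChi x * hlPsi w w' ((u + (b - b')) + (a - a') * x)| ≤ K) :
    |hlH w w' a b a' b'| ≤ 2 * K := by
  have hw' : 0 < w' := hw.trans_le hww
  have hK : 0 ≤ K := (abs_nonneg _).trans (h 0 (by simp; positivity))
  rw [hlH_eq a b a' b' hw hww, ← Real.norm_eq_abs]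
  have := MeasureTheory.norm_integral_le_of_norm_le
    (f := fun u => hlPsi w w' u * ∫ x, hlChi x * hlPsi w w' ((u + (b - b')) + (a - a') * x))
    (g := fun u => |hlPsi w w' u| * K) ((hlPsi_integrable hw hww).abs.mul_const K)
    (Filter.Eventually.of_forall ?_)
  · refine this.trans ?_
    rw [MeasureTheory.integral_mul_const]
    exact mul_le_mul_of_nonneg_right (hlPsi_int_abs hw hww) hK
  · intro u
    rw [Real.norm_eq_abs, abs_mul]
    by_cases hu : hlPsi w w' u = 0
    · simp [hu]
    · exact mul_le_mul_of_nonneg_left (h u (hlPsi_supp hww hu)) (abs_nonneg _)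

lemma hlH_near {w w' : ℝ} (a b a' b' : ℝ) (hw : 0 < w) (hww : w ≤ w') :
    |hlH w w' a b a' b'| ≤ 2 * (1 / w) :=
  hlH_le_of hw hww fun _ _ => hl_G_near hw hww

lemma hlH_far {w w' a b a' b' D : ℝ} (hw : 0 < w) (hww : w ≤ w')
    (hD : D ≤ max |a - a'| |b - b'|) (hD0 : 0 < D) :
    |hlH w w' a b a' b'| ≤ 600000 * w' ^ 2 / (w * D ^ 2) := by
  have hw' : 0 < w' := hw.trans_le hww
  rcases le_or_gt D (544 * w') with h1 | h1
  · refine (hlH_near a b a' b' hw hww).trans ?_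
    rw [le_div_iff₀ (by positivity)]
    have : 2 * (1 / w) * (w * D ^ 2) = 2 * D ^ 2 := by field_simp
    rw [this]
    nlinarith
  · rcases le_or_gt (D / 8) |a - a'| with h2 | h2
    · have hα : a - a' ≠ 0 := by
        intro h; rw [h] at h2; simp at h2; linarith
      refine (hlH_le_of hw hww fun u _ => hl_G_far hw hww hα).trans ?_
      have h3 : (D / 8) ^ 2 ≤ (a - a') ^ 2 := by
        rw [← sq_abs (a - a')]; gcongr
      have h4 : 68 * w' / (a - a') ^ 2 ≤ 68 * w' / (D / 8) ^ 2 := by gcongr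
      refine (mul_le_mul_of_nonneg_left h4 (by norm_num)).trans ?_
      rw [le_div_iff₀ (by positivity)]
      have : 2 * (68 * w' / (D / 8) ^ 2) * (w * D ^ 2) = 8704 * (w * w') := by
        field_simp; norm_num
      rw [this]
      nlinarith
    · have h3 : D ≤ |b - b'| := by
        rcases le_max_iff.1 hD with h | h
        · linarith
        · exact h
      have : |hlH w w' a b a' b'| ≤ 2 * 0 := by
        apply hlH_le_of hw hww
        intro u hu
        apply le_of_eq
        rw [abs_eq_zero]
        rw [← MeasureTheory.integral_zero ℝ ℝ]
        apply MeasureTheory.integral_congr_ae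
        refine Filter.Eventually.of_forall fun x => ?_
        simp only
        by_contra hne
        have hx := hlChi_supp (left_ne_zero_of_mul hne)
        have hp := hlPsi_supp hww (right_ne_zero_of_mul hne)
        have hx3 : |x| ≤ 3 := abs_le.2 ⟨by linarith, by linarith⟩
        have e : b - b' = (u + (b - b') + (a - a') * x) - u - (a - a') * x := by ring
        have h4 := abs_sub (u + (b - b') + (a - a') * x - u) ((a - a') * x)
        have h5 := abs_sub (u + (b - b') + (a - a') * x) u
        rw [← e] at h4
        have h6 : |(a - a') * x| ≤ D / 8 * 3 := by rw [abs_mul]; gcongr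
        linarith
      refine this.trans ?_
      simp; positivity

/-- the incidence count at scale `r`. -/
def hlV {ι κ : Type*} (P : Finset ι) (S : Finset κ) (X Y : ι → ℝ) (a b : κ → ℝ) (r : ℝ) : ℝ :=
  ∑ j ∈ S, (((P.filter fun q => |Y q - a j * X q - b j| ≤ 32 * r).card : ℕ) : ℝ)

/-- the pair count at scale `r`. -/
def hlN {κ : Type*} (S : Finset κ) (a b : κ → ℝ) (r : ℝ) : ℝ :=
  ∑ j ∈ S, (((S.filter fun j' => |a j - a j'| ≤ r ∧ |b j - b j'| ≤ r).card : ℕ) : ℝ)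

/-- normalised square. -/
def hlSq (w x y : ℝ) (z : ℝ × ℝ) : ℝ :=
  (Set.Icc x (x + w) ×ˢ Set.Icc y (y + w)).indicator (fun _ => 1 / w ^ 2) z

lemma hlSq_nonneg (w x y : ℝ) (z : ℝ × ℝ) : 0 ≤ hlSq w x y z := by
  unfold hlSq
  apply Set.indicator_nonneg
  intro _ _; positivity

lemma hlSq_le (w x y : ℝ) (z : ℝ × ℝ) : hlSq w x y z ≤ 1 / w ^ 2 := by
  unfold hlSq Set.indicator
  split_ifs
  · exact le_rfl
  · positivity

lemma hlSq_meas (w x y : ℝ) : Measurable (hlSq w x y) := by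
  unfold hlSq
  exact measurable_const.indicator (measurableSet_Icc.prod measurableSet_Icc)

lemma hlSq_supp {w x y : ℝ} {z : ℝ × ℝ} (h : hlSq w x y z ≠ 0) :
    (x ≤ z.1 ∧ z.1 ≤ x + w) ∧ (y ≤ z.2 ∧ z.2 ≤ y + w) := by
  unfold hlSq at h
  have := Set.mem_of_indicator_ne_zero h
  exact ⟨this.1, this.2⟩

lemma hlSq_mul_integrable {w x y : ℝ} {g : ℝ × ℝ → ℝ} (hw : 0 < w) (hg : Measurable g) {C : ℝ}
    (hC : ∀ z, |g z| ≤ C) : MeasureTheory.Integrable (fun z => hlSq w x y z * g z) := by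
  refine hl_integrable2 (C := 1 / w ^ 2 * C) (L := |x| + |y| + w)
    ((hlSq_meas w x y).mul hg) ?_ ?_
  · intro z
    rw [abs_mul, abs_of_nonneg (hlSq_nonneg _ _ _ _)]
    exact mul_le_mul (hlSq_le _ _ _ _) (hC z) (abs_nonneg _) (by positivity)
  · intro z hz
    obtain ⟨⟨h1, h2⟩, h3, h4⟩ := hlSq_supp (left_ne_zero_of_mul hz)
    have := abs_le.1 (le_refl |x|)
    have := abs_le.1 (le_refl |y|)
    have := abs_nonneg x
    have := abs_nonneg y
    exact ⟨abs_le.2 ⟨by linarith, by linarith⟩, abs_le.2 ⟨by linarith, by linarith⟩⟩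

lemma hlSq_integrable {w x y : ℝ} (hw : 0 < w) : MeasureTheory.Integrable (hlSq w x y) := by
  have := hlSq_mul_integrable (x := x) (y := y) (g := fun _ => 1) hw measurable_const (C := 1)
    (by intro z; simp)
  simpa using this

lemma hlSq_int {w x y : ℝ} (hw : 0 < w) : ∫ z, hlSq w x y z = 1 := by
  unfold hlSq
  rw [MeasureTheory.integral_indicator_const _ (measurableSet_Icc.prod measurableSet_Icc),
    MeasureTheory.Measure.volume_eq_prod, MeasureTheory.measureReal_prod_prod,
    Real.volume_real_Icc_of_le (by linarith), Real.volume_real_Icc_of_le (by linarith),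
    smul_eq_mul]
  field_simp
  ring

lemma hlSq_box_integrable {w x y r a b : ℝ} (hw : 0 < w) (hr : 0 < r) :
    MeasureTheory.Integrable (fun z => hlSq w x y z * hlBox r (z.2 - a * z.1 - b)) := by
  apply hlSq_mul_integrable hw (C := 1 / (68 * r))
  · exact (hlBox_meas r).comp (by fun_prop)
  · intro z; rw [abs_of_nonneg (hlBox_nonneg hr _)]; exact hlBox_le hr _

lemma hl_dev {w x y a b : ℝ} {z : ℝ × ℝ} (ha : |a| ≤ 1)
    (h : (x ≤ z.1 ∧ z.1 ≤ x + w) ∧ (y ≤ z.2 ∧ z.2 ≤ y + w)) :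
    |(z.2 - a * z.1 - b) - (y - a * x - b)| ≤ 2 * w := by
  have e : (z.2 - a * z.1 - b) - (y - a * x - b) = (z.2 - y) - a * (z.1 - x) := by ring
  have h1 : |z.2 - y| ≤ w := abs_le.2 ⟨by linarith [h.2.1, h.2.2], by linarith [h.2.2]⟩
  have h2 : |z.1 - x| ≤ w := abs_le.2 ⟨by linarith [h.1.1, h.1.2], by linarith [h.1.2]⟩
  have h3 : |a * (z.1 - x)| ≤ 1 * w := by rw [abs_mul]; gcongr
  rw [e]
  have := abs_sub (z.2 - y) (a * (z.1 - x))
  linarith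

lemma hl_s1 {w x y a b : ℝ} (hw : 0 < w) (ha : |a| ≤ 1) (h : |y - a * x - b| ≤ 32 * w) :
    1 = 68 * w * ∫ z, hlSq w x y z * hlBox w (z.2 - a * z.1 - b) := by
  have e : (fun z : ℝ × ℝ => hlSq w x y z * hlBox w (z.2 - a * z.1 - b))
      = fun z => hlSq w x y z * (1 / (68 * w)) := by
    funext z
    by_cases hz : hlSq w x y z = 0
    · simp [hz]
    · congr 1
      have h2 := hl_dev (b := b) ha (hlSq_supp hz)
      unfold hlBox
      rw [if_pos]
      have := abs_sub_abs_le_abs_sub (z.2 - a * z.1 - b) (y - a * x - b)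
      linarith
  rw [e, MeasureTheory.integral_mul_const, hlSq_int hw]
  field_simp

lemma hl_s2 {w w' x y a b : ℝ} (hw : 0 < w) (hww : w ≤ w') (ha : |a| ≤ 1) :
    ∫ z, hlSq w x y z * hlBox w' (z.2 - a * z.1 - b)
      ≤ 1 / (68 * w') * (if |y - a * x - b| ≤ 32 * (2 * w') then 1 else 0) := by
  have hw' : 0 < w' := hw.trans_le hww
  split_ifs with h
  · calc ∫ z, hlSq w x y z * hlBox w' (z.2 - a * z.1 - b)
        ≤ ∫ z, hlSq w x y z * (1 / (68 * w')) := by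
          apply MeasureTheory.integral_mono (hlSq_box_integrable hw hw')
            ((hlSq_integrable hw).mul_const _)
          intro z
          exact mul_le_mul_of_nonneg_left (hlBox_le hw' _) (hlSq_nonneg _ _ _ _)
      _ = _ := by rw [MeasureTheory.integral_mul_const, hlSq_int hw]; ring
  · rw [mul_zero]
    apply le_of_eq
    rw [← MeasureTheory.integral_zero (ℝ × ℝ) ℝ]
    apply MeasureTheory.integral_congr_ae
    refine Filter.Eventually.of_forall fun z => ?_
    simp only
    by_contra hne
    have h2 := hl_dev (b := b) ha (hlSq_supp (left_ne_zero_of_mul hne))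
    have h3 : |z.2 - a * z.1 - b| ≤ 34 * w' := by
      by_contra h4
      apply right_ne_zero_of_mul hne
      unfold hlBox
      rw [if_neg h4]
    apply h
    have h5 := abs_sub_abs_le_abs_sub (y - a * x - b) (z.2 - a * z.1 - b)
    rw [abs_sub_comm (y - a * x - b) (z.2 - a * z.1 - b)] at h5
    linarith

lemma hl_main {ι κ : Type*} (P : Finset ι) (S : Finset κ) (X Y : ι → ℝ) (a b : κ → ℝ)
    {w w' g : ℝ} (hw : 0 < w) (hw1 : w ≤ 1) (hww : w ≤ w')
    (hX : ∀ q ∈ P, 0 ≤ X q ∧ X q ≤ 1) (ha : ∀ j ∈ S, |a j| ≤ 1)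
    (hg : ∀ x y : ℝ, (((P.filter fun q => |X q - x| ≤ w ∧ |Y q - y| ≤ w).card : ℕ) : ℝ) ≤ g) :
    ∃ Z : ℝ, hlV P S X Y a b w ≤ w / w' * hlV P S X Y a b (2 * w') + 68 * w * Z ∧
      Z ^ 2 ≤ (g * (P.card : ℝ) / w ^ 2) *
        ∑ j ∈ S, ∑ j' ∈ S, |hlH w w' (a j) (b j) (a j') (b j')| := by
  have hw' : 0 < w' := hw.trans_le hww
  set B : ι → ℝ × ℝ → ℝ := fun q => hlSq w (X q) (Y q) with hB
  set m : ℝ × ℝ → ℝ := fun z => ∑ q ∈ P, B q z with hm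
  set f : ℝ × ℝ → ℝ := fun z => ∑ j ∈ S, hlPsi w w' (z.2 - a j * z.1 - b j) with hf
  have hBψ : ∀ q j, MeasureTheory.Integrable
      (fun z => B q z * hlPsi w w' (z.2 - a j * z.1 - b j)) := by
    intro q j
    apply hlSq_mul_integrable hw (C := 1 / (68 * w))
    · exact (hlPsi_meas w w').comp (by fun_prop)
    · intro z; exact hlPsi_abs_le hw hww _
  have hZ : (∫ z, m z * f z) = ∑ j ∈ S, ∑ q ∈ P,
      ∫ z, B q z * hlPsi w w' (z.2 - a j * z.1 - b j) := by
    have e : (fun z => m z * f z) = fun z => ∑ j ∈ S, ∑ q ∈ P,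
        B q z * hlPsi w w' (z.2 - a j * z.1 - b j) := by
      funext z
      simp only [hm, hf]
      rw [Finset.sum_mul_sum, Finset.sum_comm]
    rw [e, MeasureTheory.integral_finsetSum]
    · apply Finset.sum_congr rfl
      intro j _
      rw [MeasureTheory.integral_finsetSum]
      intro q _
      exact hBψ q j
    · intro j _
      exact MeasureTheory.integrable_finsetSum _ fun q _ => hBψ q j
  refine ⟨∫ z, m z * f z, ?_, ?_⟩
  · rw [hZ]
    unfold hlV
    rw [Finset.mul_sum, Finset.mul_sum, ← Finset.sum_add_distrib]
    apply Finset.sum_le_sum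
    intro j hj
    rw [Finset.card_filter, Finset.card_filter]
    push_cast
    rw [Finset.mul_sum, Finset.mul_sum, ← Finset.sum_add_distrib]
    apply Finset.sum_le_sum
    intro q hq
    have h1 : (if |Y q - a j * X q - b j| ≤ 32 * w then (1 : ℝ) else 0)
        ≤ 68 * w * ∫ z, B q z * hlBox w (z.2 - a j * z.1 - b j) := by
      split_ifs with h
      · exact le_of_eq (hl_s1 hw (ha j hj) h)
      · apply mul_nonneg (by positivity)
        apply MeasureTheory.integral_nonneg
        intro z
        exact mul_nonneg (hlSq_nonneg _ _ _ _) (hlBox_nonneg hw _)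
    have h2 := hl_s2 (x := X q) (y := Y q) (b := b j) hw hww (ha j hj)
    have h3 : (∫ z, B q z * hlPsi w w' (z.2 - a j * z.1 - b j))
        = (∫ z, B q z * hlBox w (z.2 - a j * z.1 - b j))
          - ∫ z, B q z * hlBox w' (z.2 - a j * z.1 - b j) := by
      rw [← MeasureTheory.integral_sub (hlSq_box_integrable hw hw) (hlSq_box_integrable hw hw')]
      simp only [hlPsi, mul_sub, hB]
    refine h1.trans ?_
    rw [h3]
    have h4 := mul_le_mul_of_nonneg_left h2 (show 0 ≤ 68 * w by positivity)
    have h5 : 68 * w * (1 / (68 * w') * (if |Y q - a j * X q - b j| ≤ 32 * (2 * w') then 1 else 0))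
        = w / w' * (if |Y q - a j * X q - b j| ≤ 32 * (2 * w') then 1 else 0) := by
      field_simp
    rw [h5] at h4
    simp only [hB] at h4 ⊢
    linarith
  · have hm_nonneg : ∀ z, 0 ≤ m z := fun z => Finset.sum_nonneg fun q _ => hlSq_nonneg _ _ _ _
    have hm_int : MeasureTheory.Integrable m :=
      MeasureTheory.integrable_finsetSum _ fun q _ => hlSq_integrable hw
    have hm_meas : Measurable m := by
      simp only [hm]
      exact Finset.measurable_fun_sum _ fun q _ => hlSq_meas _ _ _
    have hf_meas : Measurable f := by
      simp only [hf]
      exact Finset.measurable_fun_sum _ fun q _ => (hlPsi_meas w w').comp (by fun_prop)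
    have hm_le : ∀ z, m z ≤ g / w ^ 2 := by
      intro z
      have : m z ≤ 1 / w ^ 2 *
          (((P.filter fun q => |X q - z.1| ≤ w ∧ |Y q - z.2| ≤ w).card : ℕ) : ℝ) := by
        rw [Finset.card_filter]
        push_cast
        rw [Finset.mul_sum]
        apply Finset.sum_le_sum
        intro q _
        by_cases hz : B q z = 0
        · rw [hz]; split_ifs <;> positivity
        · obtain ⟨⟨h1, h2⟩, h3, h4⟩ := hlSq_supp hz
          rw [if_pos ⟨abs_le.2 ⟨by linarith, by linarith⟩, abs_le.2 ⟨by linarith, by linarith⟩⟩,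
            mul_one]
          exact hlSq_le _ _ _ _
      refine this.trans ?_
      rw [div_eq_mul_one_div g, mul_comm g]
      exact mul_le_mul_of_nonneg_left (hg _ _) (by positivity)
    have hm2_int : MeasureTheory.Integrable (fun z => m z ^ 2) := by
      simp only [pow_two]
      apply hm_int.mul_bdd (c := g / w ^ 2) hm_meas.aestronglyMeasurable
      refine Filter.Eventually.of_forall fun z => ?_
      rw [Real.norm_eq_abs, abs_of_nonneg (hm_nonneg z)]
      exact hm_le z
    have hm_int1 : ∫ z, m z = P.card := by
      simp only [hm]
      rw [MeasureTheory.integral_finsetSum _ fun q _ => hlSq_integrable hw]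
      simp [hB, hlSq_int hw]
    have hm2 : ∫ z, m z ^ 2 ≤ g * (P.card : ℝ) / w ^ 2 := by
      calc ∫ z, m z ^ 2 ≤ ∫ z, g / w ^ 2 * m z := by
            apply MeasureTheory.integral_mono hm2_int (hm_int.const_mul _)
            intro z
            simp only [pow_two (m z)]
            exact mul_le_mul_of_nonneg_right (hm_le z) (hm_nonneg z)
        _ = _ := by rw [MeasureTheory.integral_const_mul, hm_int1]; ring
    have hχe : (fun z : ℝ × ℝ => hlChi z.1 * f z ^ 2) = fun z => ∑ j ∈ S, ∑ j' ∈ S,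
        hlChi z.1 * (hlPsi w w' (z.2 - a j * z.1 - b j) *
          hlPsi w w' (z.2 - a j' * z.1 - b j')) := by
      funext z
      simp only [hf, pow_two]
      rw [Finset.sum_mul_sum, Finset.mul_sum]
      apply Finset.sum_congr rfl
      intro j _
      rw [Finset.mul_sum]
    have hχ_int : MeasureTheory.Integrable (fun z : ℝ × ℝ => hlChi z.1 * f z ^ 2) := by
      rw [hχe]
      exact MeasureTheory.integrable_finsetSum _ fun j _ =>
        MeasureTheory.integrable_finsetSum _ fun j' _ => hlH_integrable _ _ _ _ hw hww
    have hχ : ∫ z : ℝ × ℝ, hlChi z.1 * f z ^ 2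
        ≤ ∑ j ∈ S, ∑ j' ∈ S, |hlH w w' (a j) (b j) (a j') (b j')| := by
      rw [hχe, MeasureTheory.integral_finsetSum _ fun j _ =>
        MeasureTheory.integrable_finsetSum _ fun j' _ => hlH_integrable _ _ _ _ hw hww]
      apply Finset.sum_le_sum
      intro j _
      rw [MeasureTheory.integral_finsetSum _ fun j' _ => hlH_integrable _ _ _ _ hw hww]
      exact Finset.sum_le_sum fun j' _ => le_abs_self _
    have hmf_int : MeasureTheory.Integrable (fun z => m z * f z) := by
      apply hm_int.mul_bdd (c := ∑ j ∈ S, 1 / (68 * w)) hf_meas.aestronglyMeasurable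
      refine Filter.Eventually.of_forall fun z => ?_
      refine (norm_sum_le _ _).trans ?_
      exact Finset.sum_le_sum fun j _ => hlPsi_abs_le hw hww _
    have hquad : ∀ t : ℝ, 0 ≤ (∫ z, m z ^ 2) * (t * t) + (-(2 * ∫ z, m z * f z)) * t
        + ∫ z : ℝ × ℝ, hlChi z.1 * f z ^ 2 := by
      intro t
      have e : (∫ z, m z ^ 2) * (t * t) + (-(2 * ∫ z, m z * f z)) * t
          + (∫ z : ℝ × ℝ, hlChi z.1 * f z ^ 2)
          = ∫ z, (m z ^ 2 * (t * t) + (m z * f z) * (-(2 * t)) + hlChi z.1 * f z ^ 2) := by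
        have i1 : MeasureTheory.Integrable
            (fun z => m z ^ 2 * (t * t) + (m z * f z) * (-(2 * t))) :=
          (hm2_int.mul_const _).add (hmf_int.mul_const _)
        rw [MeasureTheory.integral_add i1 hχ_int,
          MeasureTheory.integral_add (hm2_int.mul_const _) (hmf_int.mul_const _),
          MeasureTheory.integral_mul_const, MeasureTheory.integral_mul_const]
        ring
      rw [e]
      apply MeasureTheory.integral_nonneg
      intro z
      simp only [Pi.zero_apply]
      by_cases hz : m z = 0
      · rw [hz]
        have := mul_nonneg (hlChi_nonneg z.1) (sq_nonneg (f z))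
        simpa using this
      · obtain ⟨q, hq, hqz⟩ := Finset.exists_ne_zero_of_sum_ne_zero hz
        obtain ⟨⟨h1, h2⟩, -, -⟩ := hlSq_supp hqz
        have h3 := hlChi_ge (x := z.1) (by linarith [hX q hq]) (by linarith [hX q hq])
        have h4 : f z ^ 2 ≤ hlChi z.1 * f z ^ 2 := by
          nlinarith [sq_nonneg (f z)]
        nlinarith [sq_nonneg (t * m z - f z)]
    have hd := discrim_le_zero hquad
    unfold discrim at hd
    have h0 : 0 ≤ ∫ z, m z ^ 2 := MeasureTheory.integral_nonneg fun z => sq_nonneg _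
    have h0' : 0 ≤ ∫ z : ℝ × ℝ, hlChi z.1 * f z ^ 2 :=
      MeasureTheory.integral_nonneg fun z => mul_nonneg (hlChi_nonneg _) (sq_nonneg _)
    calc (∫ z, m z * f z) ^ 2 ≤ (∫ z, m z ^ 2) * ∫ z : ℝ × ℝ, hlChi z.1 * f z ^ 2 := by
          nlinarith
      _ ≤ _ := mul_le_mul hm2 hχ h0' (h0.trans hm2)

lemma hl_kern {w w' a b a' b' : ℝ} (hw : 0 < w) (hww : w ≤ w') (I : ℕ)
    (hI : |a - a'| ≤ 2 ^ I * w' ∧ |b - b'| ≤ 2 ^ I * w') :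
    |hlH w w' a b a' b'| ≤ 2400000 / w * ∑ i ∈ Finset.range (I + 1), (1 / 4 : ℝ) ^ i *
      (if |a - a'| ≤ 2 ^ i * w' ∧ |b - b'| ≤ 2 ^ i * w' then 1 else 0) := by
  have hw' : 0 < w' := hw.trans_le hww
  have hex : ∃ i : ℕ, |a - a'| ≤ 2 ^ i * w' ∧ |b - b'| ≤ 2 ^ i * w' := ⟨I, hI⟩
  set i := Nat.find hex with hi
  have hspec := Nat.find_spec hex
  rw [← hi] at hspec
  have hle : i ≤ I := Nat.find_min' hex hI
  have hsum : (1 / 4 : ℝ) ^ i ≤ ∑ i ∈ Finset.range (I + 1), (1 / 4 : ℝ) ^ i *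
      (if |a - a'| ≤ 2 ^ i * w' ∧ |b - b'| ≤ 2 ^ i * w' then 1 else 0) := by
    have := Finset.single_le_sum (f := fun i => (1 / 4 : ℝ) ^ i *
      (if |a - a'| ≤ 2 ^ i * w' ∧ |b - b'| ≤ 2 ^ i * w' then 1 else 0))
      (s := Finset.range (I + 1)) (fun k _ => by positivity)
      (Finset.mem_range.2 (Nat.lt_succ_of_le hle))
    rwa [if_pos hspec, mul_one] at this
  refine le_trans ?_ (mul_le_mul_of_nonneg_left hsum (by positivity))
  rcases Nat.eq_zero_or_pos i with h0 | h0
  · rw [h0, pow_zero, mul_one]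
    refine (hlH_near a b a' b' hw hww).trans ?_
    rw [mul_one_div]
    gcongr
    norm_num
  · obtain ⟨k, hk⟩ : ∃ k, i = k + 1 := ⟨i - 1, by omega⟩
    have hmin := Nat.find_min hex (m := k) (by omega)
    have hD : 2 ^ k * w' ≤ max |a - a'| |b - b'| := by
      by_contra hlt
      push Not at hlt
      exact hmin ⟨(le_max_left _ _).trans hlt.le, (le_max_right _ _).trans hlt.le⟩
    refine (hlH_far hw hww hD (by positivity)).trans (le_of_eq ?_)
    rw [hk]
    rw [one_div, inv_pow, pow_succ (4 : ℝ) k, show (4 : ℝ) ^ k = 2 ^ k * 2 ^ k by rw [← mul_pow]; norm_num]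
    field_simp
    norm_num

lemma hl_kern_sum {κ : Type*} (S : Finset κ) (a b : κ → ℝ) {w w' : ℝ} (hw : 0 < w)
    (hww : w ≤ w') (I : ℕ)
    (hI : ∀ j ∈ S, ∀ j' ∈ S, |a j - a j'| ≤ 2 ^ I * w' ∧ |b j - b j'| ≤ 2 ^ I * w') :
    ∑ j ∈ S, ∑ j' ∈ S, |hlH w w' (a j) (b j) (a j') (b j')| ≤
      2400000 / w * ∑ i ∈ Finset.range (I + 1), (1 / 4 : ℝ) ^ i * hlN S a b (2 ^ i * w') := by
  calc _ ≤ ∑ j ∈ S, ∑ j' ∈ S, 2400000 / w * ∑ i ∈ Finset.range (I + 1), (1 / 4 : ℝ) ^ i *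
      (if |a j - a j'| ≤ 2 ^ i * w' ∧ |b j - b j'| ≤ 2 ^ i * w' then (1 : ℝ) else 0) :=
        Finset.sum_le_sum fun j hj => Finset.sum_le_sum fun j' hj' =>
          hl_kern hw hww I (hI j hj j' hj')
    _ = _ := by
      simp only [← Finset.mul_sum]
      congr 1
      unfold hlN
      have : ∀ j ∈ S, ∑ j' ∈ S, ∑ i ∈ Finset.range (I + 1), (1 / 4 : ℝ) ^ i *
          (if |a j - a j'| ≤ 2 ^ i * w' ∧ |b j - b j'| ≤ 2 ^ i * w' then (1 : ℝ) else 0)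
          = ∑ i ∈ Finset.range (I + 1), (1 / 4 : ℝ) ^ i *
            (((S.filter fun j' => |a j - a j'| ≤ 2 ^ i * w' ∧ |b j - b j'| ≤ 2 ^ i * w').card : ℕ)
              : ℝ) := by
        intro j _
        rw [Finset.sum_comm]
        apply Finset.sum_congr rfl
        intro i _
        rw [Finset.card_filter]
        push_cast
        rw [Finset.mul_sum]
      rw [Finset.sum_congr rfl this, Finset.sum_comm]
      apply Finset.sum_congr rfl
      intro i _
      rw [Finset.mul_sum]

/-- One step of the induction on scales. -/
lemma hl_step {ι κ : Type*} (P : Finset ι) (S : Finset κ) (X Y : ι → ℝ) (a b : κ → ℝ)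
    {w R γ Λ M G : ℝ} {β : ℝ → ℝ} (hw : 0 < w) (hw1 : w ≤ 1) (hR : 1 ≤ R)
    (hX : ∀ q ∈ P, 0 ≤ X q ∧ X q ≤ 1) (ha : ∀ j ∈ S, |a j| ≤ 1) (hγ : 0 ≤ γ)
    (hg : ∀ x y : ℝ, (((P.filter fun q => |X q - x| ≤ w ∧ |Y q - y| ≤ w).card : ℕ) : ℝ)
      ≤ γ * P.card)
    (I : ℕ) (hI : ∀ j ∈ S, ∀ j' ∈ S, |a j - a j'| ≤ 2 ^ I * (R * w) ∧
      |b j - b j'| ≤ 2 ^ I * (R * w))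
    (hM : 0 ≤ M) (hMS : (P.card : ℝ) * M ≤ 2 * S.card)
    (hN : ∀ r, w ≤ r → hlN S a b r ≤ β r * M * hlV P S X Y a b r)
    (hβ0 : ∀ r, w ≤ r → 0 ≤ β r)
    (hβ : ∀ l, 1 ≤ l → β (l * w) ≤ l * β w)
    (hΛ : β w * γ ≤ Λ * w ^ 2)
    (hG : ((I : ℝ) + 1) * Λ * R ^ 2 ≤ G) (hG0 : 0 ≤ G)
    (hV : ∀ r, R * w ≤ r → hlV P S X Y a b r ≤ G * r * P.card * S.card) :
    hlV P S X Y a b w ≤ 150002 * 2 * G * w * P.card * S.card := by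
  have hww : w ≤ R * w := by nlinarith
  have hw' : 0 < R * w := by positivity
  obtain ⟨Z, hZ1, hZ2⟩ := hl_main P S X Y a b hw hw1 hww hX ha hg
  have hk := hl_kern_sum S a b hw hww I hI
  have hc : (0 : ℝ) ≤ P.card := by positivity
  have hc' : (0 : ℝ) ≤ S.card := by positivity
  have hsum : ∑ i ∈ Finset.range (I + 1), (1 / 4 : ℝ) ^ i * hlN S a b (2 ^ i * (R * w))
      ≤ ((I : ℝ) + 1) * (β w * M * G * R ^ 2 * w * P.card * S.card) := by
    have : ∀ i ∈ Finset.range (I + 1), (1 / 4 : ℝ) ^ i * hlN S a b (2 ^ i * (R * w))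
        ≤ β w * M * G * R ^ 2 * w * P.card * S.card := by
      intro i _
      have h2i : (1 : ℝ) ≤ 2 ^ i := one_le_pow₀ (by norm_num)
      have hr1 : R * w ≤ 2 ^ i * (R * w) := by nlinarith
      have hr : w ≤ 2 ^ i * (R * w) := hww.trans hr1
      have h1 := hN _ hr
      have h2 := hV _ hr1
      have h3 : β (2 ^ i * (R * w)) ≤ 2 ^ i * R * β w := by
        have := hβ (2 ^ i * R) (by nlinarith)
        rwa [mul_assoc] at this
      have h4 := hβ0 _ hr
      calc (1 / 4 : ℝ) ^ i * hlN S a b (2 ^ i * (R * w))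
          ≤ (1 / 4 : ℝ) ^ i * ((2 ^ i * R * β w) * M *
              (G * (2 ^ i * (R * w)) * P.card * S.card)) := by
            refine mul_le_mul_of_nonneg_left (h1.trans ?_) (by positivity)
            have hβw := hβ0 w le_rfl
            have hβM : 0 ≤ 2 ^ i * R * β w * M := by positivity
            have hV0 : 0 ≤ hlV P S X Y a b (2 ^ i * (R * w)) :=
              Finset.sum_nonneg fun j _ => by positivity
            exact mul_le_mul (mul_le_mul_of_nonneg_right h3 hM) h2 hV0 hβM
        _ = _ := by
            rw [one_div, inv_pow, show (4 : ℝ) ^ i = 2 ^ i * 2 ^ i by rw [← mul_pow]; norm_num]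
            field_simp
    refine (Finset.sum_le_sum this).trans ?_
    rw [Finset.sum_const, Finset.card_range, nsmul_eq_mul]
    push_cast
    exact le_rfl
  have hβw := hβ0 w le_rfl
  have hZ3 : Z ^ 2 ≤ (2200 * G * P.card * S.card) ^ 2 := by
    calc Z ^ 2 ≤ (γ * P.card * (P.card : ℝ) / w ^ 2) * (2400000 / w *
          (((I : ℝ) + 1) * (β w * M * G * R ^ 2 * w * P.card * S.card))) := by
          refine hZ2.trans ?_
          gcongr
          refine hk.trans ?_
          gcongr
      _ = 2400000 * ((β w * γ) / w ^ 2) * (((I : ℝ) + 1) * R ^ 2) * G * (P.card : ℝ) ^ 2 *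
            ((P.card * M) * S.card) := by
          field_simp
      _ ≤ 2400000 * Λ * (((I : ℝ) + 1) * R ^ 2) * G * (P.card : ℝ) ^ 2 *
            ((2 * S.card) * S.card) := by
          have : (β w * γ) / w ^ 2 ≤ Λ := by
            rw [div_le_iff₀ (by positivity)]; exact hΛ
          have h0 : 0 ≤ (β w * γ) / w ^ 2 := by positivity
          have : 0 ≤ Λ := h0.trans this
          gcongr
      _ = 4800000 * (((I : ℝ) + 1) * Λ * R ^ 2) * (G * (P.card : ℝ) ^ 2 * (S.card : ℝ) ^ 2) := by
          ring
      _ ≤ 4800000 * G * (G * (P.card : ℝ) ^ 2 * (S.card : ℝ) ^ 2) := by gcongr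
      _ ≤ _ := by
          have : 0 ≤ (G * P.card * S.card) ^ 2 := sq_nonneg _
          nlinarith
  have hZ4 : Z ≤ 2200 * G * P.card * S.card :=
    (abs_le_of_sq_le_sq' hZ3 (by positivity)).2
  have hV2 := hV (2 * (R * w)) (by linarith)
  calc hlV P S X Y a b w ≤ w / (R * w) * (G * (2 * (R * w)) * P.card * S.card)
        + 68 * w * (2200 * G * P.card * S.card) := by
        refine hZ1.trans ?_
        gcongr
    _ = (2 + 68 * 2200) * G * w * P.card * S.card := by field_simp
    _ ≤ _ := by
        have : 0 ≤ G * w * P.card * S.card := by positivity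
        nlinarith

/-- Induction on scales. -/
lemma hl_induct {ι κ : Type*} (P : Finset ι) (S : Finset κ) (X Y : ι → ℝ) (a b : κ → ℝ)
    {δ R Λ M G : ℝ} {β γ : ℝ → ℝ} (hδ : 0 < δ) (hR : 1 ≤ R)
    (hX : ∀ q ∈ P, 0 ≤ X q ∧ X q ≤ 1) (ha : ∀ j ∈ S, |a j| ≤ 1)
    (hγ : ∀ w, δ ≤ w → w ≤ 1 → 0 ≤ γ w)
    (hg : ∀ w, δ ≤ w → w ≤ 1 → ∀ x y : ℝ,
      (((P.filter fun q => |X q - x| ≤ w ∧ |Y q - y| ≤ w).card : ℕ) : ℝ) ≤ γ w * P.card)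
    (I : ℕ) (hI : ∀ j ∈ S, ∀ j' ∈ S, |a j - a j'| ≤ 2 ^ I * δ ∧ |b j - b j'| ≤ 2 ^ I * δ)
    (hM : 0 ≤ M) (hMS : (P.card : ℝ) * M ≤ 2 * S.card)
    (hN : ∀ r, δ ≤ r → hlN S a b r ≤ β r * M * hlV P S X Y a b r)
    (hβ0 : ∀ r, δ ≤ r → 0 ≤ β r)
    (hβ : ∀ l w, 1 ≤ l → δ ≤ w → β (l * w) ≤ l * β w)
    (hΛ : ∀ w, δ ≤ w → w ≤ 1 → β w * γ w ≤ Λ * w ^ 2)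
    (hG : ((I : ℝ) + 1) * Λ * R ^ 2 ≤ G) (hG1 : 1 ≤ G) (i : ℕ) :
    ∀ r, δ ≤ r → 1 ≤ R ^ i * r →
      hlV P S X Y a b r ≤ (150002 * 2) ^ i * G * r * P.card * S.card := by
  have hbase : ∀ r, 1 ≤ r → ∀ G', 1 ≤ G' →
      hlV P S X Y a b r ≤ G' * r * P.card * S.card := by
    intro r hr G' hG'
    calc hlV P S X Y a b r ≤ ∑ j ∈ S, (P.card : ℝ) := by
          unfold hlV
          apply Finset.sum_le_sum
          intro j _
          exact_mod_cast Finset.card_filter_le _ _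
      _ = 1 * 1 * P.card * S.card := by rw [Finset.sum_const, nsmul_eq_mul]; ring
      _ ≤ _ := by gcongr
  induction i with
  | zero =>
    intro r hr h1
    simp only [pow_zero, one_mul] at h1 ⊢
    exact hbase r h1 G hG1
  | succ i ih =>
    intro r hr h1
    have hk : (1 : ℝ) ≤ (150002 * 2) ^ i := one_le_pow₀ (by norm_num)
    have hGi : G ≤ (150002 * 2) ^ i * G := by nlinarith
    rcases le_or_gt 1 r with h2 | h2
    · apply hbase r h2
      calc (1 : ℝ) ≤ G := hG1
        _ ≤ (150002 * 2) ^ (i + 1) * G := by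
          have hk' : (1 : ℝ) ≤ (150002 * 2) ^ (i + 1) := one_le_pow₀ (by norm_num)
          nlinarith
    · have hr0 : 0 < r := hδ.trans_le hr
      have hRr : r ≤ R * r := by nlinarith
      have := hl_step P S X Y a b (β := β) (γ := γ r) (Λ := Λ) (M := M)
        (G := (150002 * 2) ^ i * G) hr0 h2.le hR hX ha (hγ r hr h2.le) (hg r hr h2.le) I
        (fun j hj j' hj' => by
          have h3 := hI j hj j' hj'
          have h4 : 2 ^ I * δ ≤ 2 ^ I * (R * r) := by gcongr; linarith
          exact ⟨h3.1.trans h4, h3.2.trans h4⟩)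
        hM hMS (fun r' h => hN r' (hr.trans h)) (fun r' h => hβ0 r' (hr.trans h))
        (fun l hl => hβ l r hl hr) (hΛ r hr h2.le) (hG.trans hGi) (by linarith)
        (fun r' h => ih r' (hr.trans (hRr.trans h)) (by
          have : R ^ i * (R * r) ≤ R ^ i * r' := by gcongr
          rw [pow_succ, mul_assoc] at h1
          linarith))
      refine this.trans (le_of_eq ?_)
      rw [pow_succ]; ring

lemma hg_corner {δ : ℝ} (hδ : 0 < δ) (q : ℤ × ℤ) : ((q.1 : ℝ) * δ, (q.2 : ℝ) * δ) ∈ dSq δ q := by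
  unfold dSq
  refine ⟨⟨le_rfl, ?_⟩, ⟨le_rfl, ?_⟩⟩ <;> simp only <;> nlinarith

lemma hg_mem {δ : ℝ} {q : ℤ × ℤ} {z : ℝ × ℝ} (h : z ∈ dSq δ q) :
    ((q.1 : ℝ) * δ ≤ z.1 ∧ z.1 < (q.1 : ℝ) * δ + δ) ∧
      ((q.2 : ℝ) * δ ≤ z.2 ∧ z.2 < (q.2 : ℝ) * δ + δ) := by
  obtain ⟨⟨h1, h2⟩, h3, h4⟩ := h
  exact ⟨⟨h1, by linarith⟩, h3, by linarith⟩

lemma hg_uniq1 {δ x : ℝ} (hδ : 0 < δ) {i j : ℤ} (h1 : (i : ℝ) * δ ≤ x) (h2 : x < i * δ + δ)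
    (h3 : (j : ℝ) * δ ≤ x) (h4 : x < j * δ + δ) : i = j := by
  have a1 : (i : ℝ) < j + 1 := by
    by_contra h; push Not at h; nlinarith
  have a2 : (j : ℝ) < i + 1 := by
    by_contra h; push Not at h; nlinarith
  have b1 : i < j + 1 := by exact_mod_cast a1
  have b2 : j < i + 1 := by exact_mod_cast a2
  omega

lemma hg_uniq {δ : ℝ} (hδ : 0 < δ) {q q' : ℤ × ℤ} {z : ℝ × ℝ} (h : z ∈ dSq δ q)
    (h' : z ∈ dSq δ q') : q = q' := by
  have a := hg_mem h
  have b := hg_mem h'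
  exact Prod.ext (hg_uniq1 hδ a.1.1 a.1.2 b.1.1 b.1.2) (hg_uniq1 hδ a.2.1 a.2.2 b.2.1 b.2.2)

lemma hg_union_mem {δ : ℝ} {A : Finset (ℤ × ℤ)} {z : ℝ × ℝ} :
    z ∈ sqUnion δ A ↔ ∃ q ∈ A, z ∈ dSq δ q := by
  unfold sqUnion; simp

lemma hg_meet {δ : ℝ} (hδ : 0 < δ) {A : Finset (ℤ × ℤ)} {q : ℤ × ℤ} :
    (dSq δ q ∩ sqUnion δ A).Nonempty ↔ q ∈ A := by
  constructor
  · rintro ⟨z, hz, hz'⟩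
    obtain ⟨q', hq', h⟩ := hg_union_mem.1 hz'
    rwa [hg_uniq hδ hz h]
  · intro h
    exact ⟨_, hg_corner hδ q, hg_union_mem.2 ⟨q, h, hg_corner hδ q⟩⟩

lemma hg_cov {δ : ℝ} (hδ : 0 < δ) (A : Finset (ℤ × ℤ)) : covNum δ (sqUnion δ A) = A.card := by
  unfold covNum
  have : {q : ℤ × ℤ | (dSq δ q ∩ sqUnion δ A).Nonempty} = (A : Set (ℤ × ℤ)) := by
    ext q; simp [hg_meet hδ]
  rw [this]; simp

lemma hg_ds {δ s C r : ℝ} (hδ : 0 < δ) (hr : δ ≤ r) (hr1 : r ≤ 1) {A F : Finset (ℤ × ℤ)}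
    (hA : IsDSSet δ s C (sqUnion δ A)) (hF : F ⊆ A) (x y : ℝ)
    (hx : ∀ q ∈ F, |(q.1 : ℝ) * δ - x| < r ∧ |(q.2 : ℝ) * δ - y| < r) :
    (F.card : ℝ) ≤ C * r ^ s * A.card := by
  have h := hA (x, y) r hr hr1
  rw [hg_cov hδ] at h
  refine le_trans ?_ h
  unfold covNum
  have hfin : {q : ℤ × ℤ | (dSq δ q ∩ (sqUnion δ A ∩ Metric.ball (x, y) r)).Nonempty}.Finite := by
    apply A.finite_toSet.subset
    rintro q ⟨z, hz, hz', -⟩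
    exact (hg_meet hδ).1 ⟨z, hz, hz'⟩
  have hsub : (F : Set (ℤ × ℤ)) ⊆
      {q : ℤ × ℤ | (dSq δ q ∩ (sqUnion δ A ∩ Metric.ball (x, y) r)).Nonempty} := by
    intro q hq
    refine ⟨_, hg_corner hδ q, hg_union_mem.2 ⟨q, hF hq, hg_corner hδ q⟩, ?_⟩
    rw [Metric.mem_ball, Prod.dist_eq, max_lt_iff, Real.dist_eq, Real.dist_eq]
    exact hx q hq
  have := Nat.card_mono hfin hsub
  rw [Nat.card_coe_set_eq, Set.ncard_coe_finset] at this
  exact_mod_cast this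

lemma hg_par1 {δ x : ℝ} (hδ : 0 < δ) {S i : ℤ} (hS : 0 < S) (h1 : (i : ℝ) * δ ≤ x)
    (h2 : x < i * δ + δ) : ((Int.fdiv i S : ℤ) : ℝ) * (S * δ) ≤ x ∧
      x < ((Int.fdiv i S : ℤ) : ℝ) * (S * δ) + S * δ := by
  rw [Int.fdiv_eq_ediv_of_nonneg _ hS.le]
  have a1 : i / S * S ≤ i := Int.ediv_mul_le _ hS.ne'
  have a2 : i + 1 ≤ i / S * S + S := by
    have := Int.lt_ediv_add_one_mul_self i hS
    linarith
  have b1 : ((i / S : ℤ) : ℝ) * S ≤ i := by exact_mod_cast a1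
  have b2 : (i : ℝ) + 1 ≤ ((i / S : ℤ) : ℝ) * S + S := by exact_mod_cast a2
  constructor
  · nlinarith
  · nlinarith

lemma hg_par {δ : ℝ} (hδ : 0 < δ) {S : ℤ} (hS : 0 < S) (q : ℤ × ℤ) :
    dSq δ q ⊆ dSq (S * δ) (parQ S q) := by
  intro z hz
  have h := hg_mem hz
  have h1 := hg_par1 hδ hS h.1.1 h.1.2
  have h2 := hg_par1 hδ hS h.2.1 h.2.2
  unfold dSq parQ
  refine ⟨⟨h1.1, ?_⟩, ⟨h2.1, ?_⟩⟩
  · simp only; linarith [h1.2]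
  · simp only; linarith [h2.2]

lemma hg_par_meet {δ : ℝ} (hδ : 0 < δ) {S : ℤ} (hS : 0 < S) {P : Finset (ℤ × ℤ)} {Q : ℤ × ℤ} :
    (dSq (S * δ) Q ∩ sqUnion δ P).Nonempty ↔ Q ∈ P.image (parQ S) := by
  have hw : 0 < (S : ℝ) * δ := by
    have : (0 : ℝ) < S := by exact_mod_cast hS
    positivity
  rw [Finset.mem_image]
  constructor
  · rintro ⟨z, hz, hz'⟩
    obtain ⟨q, hq, h⟩ := hg_union_mem.1 hz'
    exact ⟨q, hq, hg_uniq hw (hg_par hδ hS q h) hz⟩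
  · rintro ⟨q, hq, rfl⟩
    exact ⟨_, hg_par hδ hS q (hg_corner hδ q), hg_union_mem.2 ⟨q, hq, hg_corner hδ q⟩⟩

lemma hg_par_cov {δ : ℝ} (hδ : 0 < δ) {S : ℤ} (hS : 0 < S) (P : Finset (ℤ × ℤ)) :
    covNum (S * δ) (sqUnion δ P) = (P.image (parQ S)).card := by
  unfold covNum
  have : {q : ℤ × ℤ | (dSq (S * δ) q ∩ sqUnion δ P).Nonempty}
      = ((P.image (parQ S) : Finset (ℤ × ℤ)) : Set (ℤ × ℤ)) := by
    ext q; rw [Set.mem_ofPred_eq, hg_par_meet hδ hS]; rfl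
  rw [this]; simp

lemma hg_bern (A : ℕ) {p f p' D E : ℝ} (hp : 0 < p) (hp' : 0 ≤ p')
    (hs : f + p' = p) (hD : 1 ≤ D) (hE : 0 < E)
    (h : p' ^ A * (D * E) ≤ p ^ A * ((D - 1) * E)) : p ≤ A * D * f := by
  have h7 : p' ^ A * D ≤ p ^ A * (D - 1) := by
    have : p' ^ A * D * E ≤ p ^ A * (D - 1) * E := by linarith
    exact le_of_mul_le_mul_right this hE
  have hb := one_add_mul_le_pow (a := -(f / p)) (by
    have : f / p ≤ 1 := by
      rw [div_le_one hp]; linarith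
    linarith) A
  have e : 1 + -(f / p) = p' / p := by
    field_simp; linarith
  rw [e, div_pow, le_div_iff₀ (by positivity)] at hb
  have hPA : 0 < p ^ A := by positivity
  have h8 : (1 + (A : ℝ) * -(f / p)) * D ≤ D - 1 := by
    have : p ^ A * ((1 + (A : ℝ) * -(f / p)) * D) ≤ p ^ A * (D - 1) := by nlinarith
    exact le_of_mul_le_mul_left this hPA
  have h9 : 1 ≤ (A : ℝ) * D * f / p := by
    have : (A : ℝ) * D * f / p = (A : ℝ) * (f / p) * D := by ring
    rw [this]; nlinarith
  rwa [le_div_iff₀ hp, one_mul] at h9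

/-- Pruning by maximising a potential. -/
lemma hg_prune {α β : Type*} [DecidableEq β] (P₀ : Finset α) (hP₀ : P₀.Nonempty) (n A : ℕ) (hA : 1 ≤ A)
    (f : ℕ → α → β) (hcard : P₀.card ≤ 4 ^ A) :
    ∃ P ⊆ P₀, P.Nonempty ∧ P₀.card ≤ 4 ^ n * P.card ∧
      ∀ k < n, ∀ Q ∈ P.image (f k), (P.card : ℝ) ≤
        A * (P.image (f k)).card * (P.filter fun q => f k q = Q).card := by
  set D : ℕ → Finset α → ℝ := fun k P => ((P.image (f k)).card : ℝ) with hD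
  have hDpos : ∀ k (P : Finset α), P.Nonempty → 1 ≤ D k P := by
    intro k P hP
    have : 1 ≤ (P.image (f k)).card := Finset.card_pos.2 (hP.image _)
    simp only [hD]; exact_mod_cast this
  have hDmono : ∀ k (P P' : Finset α), P ⊆ P' → D k P ≤ D k P' := by
    intro k P P' h
    simp only [hD]; exact_mod_cast Finset.card_le_card (Finset.image_subset_image h)
  have hprod : ∀ P : Finset α, P.Nonempty → 1 ≤ ∏ k ∈ Finset.range n, D k P := by
    intro P hP
    calc (1 : ℝ) = ∏ k ∈ Finset.range n, 1 := by simp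
      _ ≤ _ := Finset.prod_le_prod (fun _ _ => by norm_num) fun k _ => hDpos k P hP
  obtain ⟨P, hPm, hmax⟩ := Finset.exists_max_image (P₀.powerset.filter fun P => P.Nonempty)
    (fun P => (P.card : ℝ) ^ A / ∏ k ∈ Finset.range n, D k P)
    ⟨P₀, by simp [hP₀]⟩
  simp only [Finset.mem_filter, Finset.mem_powerset] at hPm hmax
  obtain ⟨hPsub, hPne⟩ := hPm
  have hcross : ∀ P' : Finset α, P' ⊆ P₀ → P'.Nonempty →
      (P'.card : ℝ) ^ A * ∏ k ∈ Finset.range n, D k P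
        ≤ (P.card : ℝ) ^ A * ∏ k ∈ Finset.range n, D k P' := by
    intro P' h1 h2
    have := hmax P' ⟨h1, h2⟩
    rwa [div_le_div_iff₀ (by linarith [hprod P' h2]) (by linarith [hprod P hPne])] at this
  refine ⟨P, hPsub, hPne, ?_, ?_⟩
  · have h1 := hcross P₀ le_rfl hP₀
    have h2 : (P₀.card : ℝ) ^ A ≤ (P₀.card : ℝ) ^ A * ∏ k ∈ Finset.range n, D k P :=
      le_mul_of_one_le_right (by positivity) (hprod P hPne)
    have h3 : ∏ k ∈ Finset.range n, D k P₀ ≤ ((4 : ℝ) ^ A) ^ n := by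
      calc _ ≤ ∏ k ∈ Finset.range n, (4 : ℝ) ^ A := by
            apply Finset.prod_le_prod
            · intro k _; linarith [hDpos k P₀ hP₀]
            · intro k _
              simp only [hD]
              have := (Finset.card_image_le (s := P₀) (f := f k)).trans hcard
              exact_mod_cast this
        _ = _ := by simp
    have h4 : (P₀.card : ℝ) ^ A ≤ ((4 : ℝ) ^ n * P.card) ^ A := by
      calc (P₀.card : ℝ) ^ A ≤ (P.card : ℝ) ^ A * ((4 : ℝ) ^ A) ^ n := by
            refine h2.trans (h1.trans ?_); gcongr
        _ = _ := by rw [mul_pow, ← pow_mul, ← pow_mul, mul_comm A n, mul_comm]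
    have h5 := (pow_le_pow_iff_left₀ (by positivity) (by positivity) (by omega)).1 h4
    exact_mod_cast h5
  · intro k hk Q hQ
    set F := P.filter fun q => f k q = Q with hF
    set P' := P.filter fun q => ¬ f k q = Q with hP'
    have hsum : F.card + P'.card = P.card := Finset.card_filter_add_card_filter_not _
    have hsumR : (F.card : ℝ) + P'.card = P.card := by exact_mod_cast hsum
    have hAr : (1 : ℝ) ≤ A := by exact_mod_cast hA
    have hDk := hDpos k P hPne
    have hFnn : (0 : ℝ) ≤ F.card := by positivity
    have hPpos : (0 : ℝ) < P.card := by exact_mod_cast Finset.card_pos.2 hPne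
    change (P.card : ℝ) ≤ A * D k P * F.card
    rcases P'.eq_empty_or_nonempty with h0 | h0
    · rw [h0] at hsumR
      simp only [Finset.card_empty, Nat.cast_zero, add_zero] at hsumR
      rw [← hsumR]
      exact le_mul_of_one_le_left hFnn (by nlinarith)
    · have hP'P : P' ⊆ P := Finset.filter_subset _ _
      have h1 := hcross P' (hP'P.trans hPsub) h0
      have h2 : D k P' ≤ D k P - 1 := by
        have : P'.image (f k) ⊆ (P.image (f k)).erase Q := by
          intro z hz
          obtain ⟨q, hq, rfl⟩ := Finset.mem_image.1 hz
          rw [hP', Finset.mem_filter] at hq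
          exact Finset.mem_erase.2 ⟨hq.2, Finset.mem_image_of_mem _ hq.1⟩
        have h3 := Finset.card_le_card this
        have h4 := Finset.card_erase_add_one hQ
        have h5 : (P'.image (f k)).card + 1 ≤ (P.image (f k)).card := by omega
        have h6 : D k P' + 1 ≤ D k P := by simp only [hD]; exact_mod_cast h5
        linarith
      rw [← Finset.mul_prod_erase _ _ (Finset.mem_range.2 hk),
        ← Finset.mul_prod_erase _ _ (Finset.mem_range.2 hk)] at h1
      set E := ∏ x ∈ (Finset.range n).erase k, D x P with hE
      set E' := ∏ x ∈ (Finset.range n).erase k, D x P' with hE'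
      have hEE : E' ≤ E := Finset.prod_le_prod (fun x _ => by linarith [hDpos x P' h0])
        fun x _ => hDmono x _ _ hP'P
      have hEpos : 0 < E := Finset.prod_pos fun x _ => by linarith [hDpos x P hPne]
      have hD'0 : 0 ≤ D k P' := by linarith [hDpos k P' h0]
      exact hg_bern A hPpos (by positivity) hsumR hDk hEpos (h1.trans
        (mul_le_mul_of_nonneg_left
          (mul_le_mul h2 hEE (Finset.prod_nonneg fun x _ => by linarith [hDpos x P' h0])
            (by linarith)) (by positivity)))

lemma hg_unit {δ : ℝ} (hδ : 0 < δ) {p : ℤ × ℤ} (hu : sqInUnit δ p) :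
    (0 ≤ (p.1 : ℝ) * δ ∧ (p.1 : ℝ) * δ < 1) ∧ (0 ≤ (p.2 : ℝ) * δ ∧ (p.2 : ℝ) * δ < 1) := by
  have h := hu (hg_corner hδ p)
  exact ⟨h.1, h.2⟩

lemma hg_tub {δ : ℝ} (hδ : 0 < δ) {t : ℤ × ℤ} (ht : tubeIdx δ t) : |(t.1 : ℝ) * δ| ≤ 1 := by
  obtain ⟨h1, h2⟩ := ht
  exact abs_le.2 ⟨h1, by nlinarith⟩

lemma hg_tri {x y z1 z2 a b α β u v c d : ℝ} (hz : z2 = α * z1 + β) (ha : |a| ≤ 1)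
    (h1 : |y - z2| ≤ u) (h2 : |x - z1| ≤ u) (h3 : |α - a| ≤ v) (h4 : |β - b| ≤ v)
    (h5 : |z1| ≤ c) (hd : u + v * c + u + v ≤ d) : |y - a * x - b| ≤ d := by
  have e : y - a * x - b = (y - z2) + (α - a) * z1 + a * (z1 - x) + (β - b) := by
    rw [hz]; ring
  have k1 : |(α - a) * z1| ≤ v * c := by
    rw [abs_mul]
    exact mul_le_mul h3 h5 (abs_nonneg _) ((abs_nonneg _).trans h3)
  have k2 : |a * (z1 - x)| ≤ 1 * u := by
    rw [abs_mul, abs_sub_comm]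
    exact mul_le_mul ha h2 (abs_nonneg _) (by norm_num)
  have l1 := abs_le.1 h1
  have l2 := abs_le.1 k1
  have l3 := abs_le.1 k2
  have l4 := abs_le.1 h4
  rw [e]
  exact abs_le.2 ⟨by linarith [l1.1, l2.1, l3.1, l4.1], by linarith [l1.2, l2.2, l3.2, l4.2]⟩

lemma hg_E {δ : ℝ} (hδ : 0 < δ) {p t : ℤ × ℤ} (hu : sqInUnit δ p) (ht : tubeIdx δ t)
    (h : (dTube δ t ∩ dSq δ p).Nonempty) :
    |(p.2 : ℝ) * δ - (t.1 : ℝ) * δ * ((p.1 : ℝ) * δ) - (t.2 : ℝ) * δ| ≤ 4 * δ := by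
  obtain ⟨z, ⟨ab, hab, hz⟩, hzp⟩ := h
  have h1 := hg_mem hab
  have h2 := hg_mem hzp
  have h3 := hu hzp
  refine hg_tri (u := δ) (v := δ) (c := 1) hz (hg_tub hδ ht) ?_ ?_ ?_ ?_ ?_ (by linarith)
  · exact abs_le.2 ⟨by linarith [h2.2.2], by linarith [h2.2.1]⟩
  · exact abs_le.2 ⟨by linarith [h2.1.2], by linarith [h2.1.1]⟩
  · exact abs_le.2 ⟨by linarith [h1.1.1], by linarith [h1.1.2]⟩
  · exact abs_le.2 ⟨by linarith [h1.2.1], by linarith [h1.2.2]⟩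
  · exact abs_le.2 ⟨by linarith [h3.1.1], h3.1.2.le⟩

lemma hg_final {δ : ℝ} (hδ : 0 < δ) {S : ℤ} (hS : 0 < S) (hw1 : (S : ℝ) * δ ≤ 1)
    {q T Q : ℤ × ℤ} (hu : sqInUnit δ q) (ht : tubeIdx δ T) (hq : parQ S q = Q)
    (hQ : dSq (S * δ) Q ⊆ nbTube 6 (S * δ) (parQ S T)) :
    |(q.2 : ℝ) * δ - (T.1 : ℝ) * δ * ((q.1 : ℝ) * δ) - (T.2 : ℝ) * δ| ≤ 32 * (S * δ) := by
  have hw : 0 < (S : ℝ) * δ := by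
    have : (0 : ℝ) < S := by exact_mod_cast hS
    positivity
  set w := (S : ℝ) * δ with hwd
  have hc : ((q.1 : ℝ) * δ, (q.2 : ℝ) * δ) ∈ nbTube 6 w (parQ S T) := by
    apply hQ
    rw [← hq]
    exact hg_par hδ hS q (hg_corner hδ q)
  have hc2 := Metric.cthickening_subset_thickening' (show 0 < 7 * w by positivity)
    (show 6 * w < 7 * w by linarith) _ hc
  obtain ⟨z, ⟨ab, hab, hz⟩, hd⟩ := Metric.mem_thickening_iff.1 hc2
  rw [Prod.dist_eq, max_lt_iff, Real.dist_eq, Real.dist_eq] at hd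
  have h1 := hg_mem hab
  have h2 := hg_mem (hg_par hδ hS T (hg_corner hδ T))
  rw [← hwd] at h2
  simp only at h2 hd
  have h3 := hg_unit hδ hu
  have hd1 := abs_lt.1 hd.1
  refine hg_tri (u := 7 * w) (v := w) (c := 8) hz (hg_tub hδ ht) hd.2.le hd.1.le ?_ ?_ ?_
    (by linarith)
  · exact abs_le.2 ⟨by linarith [h1.1.1, h2.1.2], by linarith [h1.1.2, h2.1.1]⟩
  · exact abs_le.2 ⟨by linarith [h1.2.1, h2.2.2], by linarith [h1.2.2, h2.2.1]⟩
  · exact abs_le.2 ⟨by linarith, by linarith⟩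

lemma hg_int_card (F : Finset ℤ) {u v : ℝ} (huv : u ≤ v)
    (h : ∀ i ∈ F, u ≤ (i : ℝ) ∧ (i : ℝ) ≤ v) :
    (F.card : ℝ) ≤ v - u + 1 := by
  have hsub : F ⊆ Finset.Icc ⌈u⌉ ⌊v⌋ := by
    intro i hi
    exact Finset.mem_Icc.2 ⟨Int.ceil_le.2 (h i hi).1, Int.le_floor.2 (h i hi).2⟩
  have h1 := Finset.card_le_card hsub
  rw [Int.card_Icc] at h1
  have h2 : (F.card : ℝ) ≤ ((⌊v⌋ + 1 - ⌈u⌉).toNat : ℝ) := by exact_mod_cast h1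
  refine h2.trans ?_
  have h3 := Int.floor_le v
  have h4 := Int.le_ceil u
  rcases le_total 0 (⌊v⌋ + 1 - ⌈u⌉) with h5 | h5
  · have : (((⌊v⌋ + 1 - ⌈u⌉).toNat : ℤ) : ℝ) = ((⌊v⌋ + 1 - ⌈u⌉ : ℤ) : ℝ) := by
      rw [Int.toNat_of_nonneg h5]
    rw [Int.cast_natCast] at this
    rw [this]; push_cast; linarith
  · rw [Int.toNat_of_nonpos h5]; simp; linarith

/-- the exponent function for tubes. -/
def hgBeta (δ s C r : ℝ) : ℝ :=
  if s ≤ 1 then 8 * C * r ^ (max s 0) else 54 * C * δ ^ (s - 1) * r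

lemma hgBeta_nonneg {δ s C r : ℝ} (hδ : 0 < δ) (hC : 0 ≤ C) (hr : 0 ≤ r) : 0 ≤ hgBeta δ s C r := by
  unfold hgBeta; split_ifs <;> positivity

lemma hgBeta_mul {δ s C w l : ℝ} (hδ : 0 < δ) (hC : 0 ≤ C) (hw : 0 < w) (hl : 1 ≤ l) :
    hgBeta δ s C (l * w) ≤ l * hgBeta δ s C w := by
  unfold hgBeta; split_ifs with h
  · rw [Real.mul_rpow (by linarith) hw.le]
    have h1 : l ^ (max s 0) ≤ l := by
      calc l ^ (max s 0) ≤ l ^ (1 : ℝ) :=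
            Real.rpow_le_rpow_of_exponent_le hl (max_le h (by norm_num))
        _ = l := Real.rpow_one l
    have h2 : 0 ≤ 8 * C * w ^ (max s 0) := by positivity
    nlinarith
  · apply le_of_eq; ring

lemma hg_lam {δ s t C w : ℝ} (n : ℕ) (hδ : 0 < δ) (hC : 0 ≤ C) (hw : δ ≤ w) (hw1 : w ≤ 1)
    (hst : 2 ≤ s + t) :
    hgBeta δ s C w * (4 ^ (n + 1) * C * w ^ (min t 2)) ≤ (54 * 4 ^ (n + 1) * C ^ 2) * w ^ 2 := by
  have hw0 : 0 < w := hδ.trans_le hw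
  have key : ∀ x : ℝ, 2 ≤ x → w ^ x ≤ w ^ 2 := by
    intro x hx
    have := Real.rpow_le_rpow_of_exponent_ge hw0 hw1 hx
    rwa [Real.rpow_two] at this
  unfold hgBeta; split_ifs with h
  · have h1 : w ^ (max s 0) * w ^ (min t 2) ≤ w ^ 2 := by
      rw [← Real.rpow_add hw0]
      apply key
      rcases le_total t 2 with h2 | h2
      · rw [min_eq_left h2]; linarith [le_max_left s 0]
      · rw [min_eq_right h2]; linarith [le_max_right s 0]
    have h2 : 0 ≤ w ^ (max s 0) * w ^ (min t 2) := by positivity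
    calc _ = 8 * (4 ^ (n + 1) * C ^ 2) * (w ^ (max s 0) * w ^ (min t 2)) := by ring
      _ ≤ 54 * (4 ^ (n + 1) * C ^ 2) * w ^ 2 := by gcongr; norm_num
      _ = _ := by ring
  · push Not at h
    have h1 : δ ^ (s - 1) * w * w ^ (min t 2) ≤ w ^ 2 := by
      have : δ ^ (s - 1) ≤ w ^ (s - 1) := Real.rpow_le_rpow hδ.le hw (by linarith)
      calc δ ^ (s - 1) * w * w ^ (min t 2) ≤ w ^ (s - 1) * w * w ^ (min t 2) := by gcongr
        _ = w ^ (s - 1 + 1 + min t 2) := by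
          rw [Real.rpow_add hw0, Real.rpow_add hw0, Real.rpow_one]
        _ ≤ _ := by
          apply key
          rcases le_total t 2 with h2 | h2
          · rw [min_eq_left h2]; linarith
          · rw [min_eq_right h2]; linarith
    calc _ = 54 * (4 ^ (n + 1) * C ^ 2) * (δ ^ (s - 1) * w * w ^ (min t 2)) := by ring
      _ ≤ 54 * (4 ^ (n + 1) * C ^ 2) * w ^ 2 := by gcongr
      _ = _ := by ring

lemma hg_gam {δ t C : ℝ} (n : ℕ) (hδ : 0 < δ) (hC : 1 ≤ C) {P P₀ : Finset (ℤ × ℤ)}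
    (hP : P ⊆ P₀) (hcard : P₀.card ≤ 4 ^ n * P.card) (hds : IsDSSet δ t C (sqUnion δ P₀))
    {w : ℝ} (hw : δ ≤ w) (hw1 : w ≤ 1) (x y : ℝ) :
    (((P.filter fun q => |(q.1 : ℝ) * δ - x| ≤ w ∧ |(q.2 : ℝ) * δ - y| ≤ w).card : ℕ) : ℝ)
      ≤ (4 ^ (n + 1) * C * w ^ (min t 2)) * P.card := by
  have hw0 : 0 < w := hδ.trans_le hw
  have hcR : (P₀.card : ℝ) ≤ 4 ^ n * P.card := by exact_mod_cast hcard
  rcases le_total (2 * w) 1 with h | h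
  · have h1 := hg_ds (r := 2 * w) hδ (by linarith) h hds
      ((Finset.filter_subset (fun q : ℤ × ℤ => |(q.1 : ℝ) * δ - x| ≤ w ∧
        |(q.2 : ℝ) * δ - y| ≤ w) P).trans hP) x y (by
        intro q hq
        rw [Finset.mem_filter] at hq
        exact ⟨by linarith [hq.2.1], by linarith [hq.2.2]⟩)
    have h2 : (2 * w) ^ t ≤ 4 * w ^ (min t 2) := by
      calc (2 * w) ^ t ≤ (2 * w) ^ (min t 2) :=
            Real.rpow_le_rpow_of_exponent_ge (by positivity) h (min_le_left _ _)
        _ = 2 ^ (min t 2) * w ^ (min t 2) := Real.mul_rpow (by norm_num) hw0.le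
        _ ≤ 2 ^ (2 : ℝ) * w ^ (min t 2) := by
            gcongr
            · norm_num
            · exact min_le_right _ _
        _ = _ := by norm_num
    calc _ ≤ C * (2 * w) ^ t * P₀.card := h1
      _ ≤ C * (4 * w ^ (min t 2)) * (4 ^ n * P.card) := by gcongr
      _ = _ := by rw [pow_succ]; ring
  · have h1 : (1 / 4 : ℝ) ≤ w ^ (min t 2) := by
      calc (1 / 4 : ℝ) ≤ w ^ 2 := by nlinarith
        _ = w ^ (2 : ℝ) := (Real.rpow_two w).symm
        _ ≤ _ := Real.rpow_le_rpow_of_exponent_ge hw0 hw1 (min_le_right _ _)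
    have h2 : (1 : ℝ) ≤ 4 ^ n := one_le_pow₀ (by norm_num)
    have h3 : (1 : ℝ) ≤ 4 ^ (n + 1) * C * w ^ (min t 2) := by
      calc (1 : ℝ) = (1 * 4) * 1 * (1 / 4) := by norm_num
        _ ≤ _ := by rw [pow_succ]; gcongr
    calc _ ≤ (P.card : ℝ) := by exact_mod_cast Finset.card_filter_le _ _
      _ ≤ _ := le_mul_of_one_le_left (by positivity) h3

lemma hg_line_card {δ r : ℝ} (hδ : 0 < δ) (hr : δ ≤ r) (F : Finset (ℤ × ℤ)) (x y α : ℝ)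
    (h1 : ∀ t ∈ F, |α - (t.1 : ℝ) * δ| ≤ r)
    (h2 : ∀ t ∈ F, |y - (t.1 : ℝ) * δ * x - (t.2 : ℝ) * δ| ≤ 4 * δ) :
    (F.card : ℝ) ≤ 27 * (r / δ) := by
  have hb : F.card ≤ 9 * (F.image Prod.fst).card := by
    apply Finset.card_le_mul_card_image
    intro i _
    have hinj : Set.InjOn Prod.snd ((F.filter fun t => t.1 = i : Finset (ℤ × ℤ)) : Set (ℤ × ℤ)) := by
      intro t ht t' ht' e
      simp only [Finset.coe_filter, Set.mem_ofPred_eq] at ht ht'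
      exact Prod.ext (ht.2.trans ht'.2.symm) e
    rw [← Finset.card_image_of_injOn hinj]
    set c := (y - (i : ℝ) * δ * x) / δ with hc
    have hcδ : c * δ = y - (i : ℝ) * δ * x := by rw [hc]; field_simp
    have := hg_int_card ((F.filter fun t => t.1 = i).image Prod.snd) (u := c - 4) (v := c + 4)
      (by linarith) (by
        intro k hk
        obtain ⟨t, ht, rfl⟩ := Finset.mem_image.1 hk
        rw [Finset.mem_filter] at ht
        have h3 := h2 t ht.1
        rw [ht.2, ← hcδ] at h3
        obtain ⟨h4, h5⟩ := abs_le.1 h3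
        constructor
        · by_contra hh; push Not at hh; nlinarith
        · by_contra hh; push Not at hh; nlinarith)
    have h9 : (((F.filter fun t => t.1 = i).image Prod.snd).card : ℝ) ≤ 9 := by linarith
    exact_mod_cast h9
  set d := α / δ with hd
  have hdδ : d * δ = α := by rw [hd]; field_simp
  set ρ := r / δ with hρ
  have hρδ : ρ * δ = r := by rw [hρ]; field_simp
  have hρ1 : 1 ≤ ρ := by rw [hρ, le_div_iff₀ hδ]; linarith
  have ha := hg_int_card (F.image Prod.fst) (u := d - ρ) (v := d + ρ) (by linarith) (by
    intro k hk
    obtain ⟨t, ht, rfl⟩ := Finset.mem_image.1 hk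
    have h3 := h1 t ht
    rw [← hdδ, ← hρδ] at h3
    obtain ⟨h4, h5⟩ := abs_le.1 h3
    constructor
    · by_contra hh; push Not at hh; nlinarith
    · by_contra hh; push Not at hh; nlinarith)
  have hbR : (F.card : ℝ) ≤ 9 * (F.image Prod.fst).card := by exact_mod_cast hb
  linarith

lemma hg_tube_count {δ s C r M : ℝ} (hδ : 0 < δ) (hδ1 : δ ≤ 1) (hC : 1 ≤ C) (hr : δ ≤ r)
    (A : Finset (ℤ × ℤ)) (hds : IsDSSet δ s C (sqUnion δ A)) (hM : (A.card : ℝ) ≤ 2 * M)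
    (x y α β : ℝ) (hE : ∀ t ∈ A, |y - (t.1 : ℝ) * δ * x - (t.2 : ℝ) * δ| ≤ 4 * δ) :
    (((A.filter fun t => |α - (t.1 : ℝ) * δ| ≤ r ∧ |β - (t.2 : ℝ) * δ| ≤ r).card : ℕ) : ℝ)
      ≤ hgBeta δ s C r * M := by
  have hr0 : 0 < r := hδ.trans_le hr
  have hM0 : 0 ≤ M := by
    have : (0 : ℝ) ≤ A.card := by positivity
    linarith
  set F := A.filter fun t => |α - (t.1 : ℝ) * δ| ≤ r ∧ |β - (t.2 : ℝ) * δ| ≤ r with hF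
  have hFA : F ⊆ A := Finset.filter_subset _ _
  have hFc : (F.card : ℝ) ≤ A.card := by exact_mod_cast Finset.card_le_card hFA
  have hFm : ∀ t ∈ F, |α - (t.1 : ℝ) * δ| ≤ r ∧ |β - (t.2 : ℝ) * δ| ≤ r := by
    intro t ht; exact (Finset.mem_filter.1 ht).2
  unfold hgBeta; split_ifs with h
  · rcases le_total s 0 with h0 | h0
    · rw [max_eq_right h0, Real.rpow_zero]
      nlinarith
    · rw [max_eq_left h0]
      rcases le_total (2 * r) 1 with h2 | h2
      · have h3 := hg_ds (r := 2 * r) hδ (by linarith) h2 hds hFA α β (by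
          intro t ht
          have := hFm t ht
          rw [abs_sub_comm, abs_sub_comm (_ * δ) β]
          exact ⟨by linarith [this.1], by linarith [this.2]⟩)
        have h4 : (2 * r) ^ s ≤ 2 * r ^ s := by
          rw [Real.mul_rpow (by norm_num) hr0.le]
          have : (2 : ℝ) ^ s ≤ 2 ^ (1 : ℝ) :=
            Real.rpow_le_rpow_of_exponent_le (by norm_num) h
          rw [Real.rpow_one] at this
          gcongr
        calc (F.card : ℝ) ≤ C * (2 * r) ^ s * A.card := h3
          _ ≤ C * (2 * r ^ s) * (2 * M) := by gcongr
          _ ≤ _ := by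
            have : 0 ≤ C * r ^ s * M := by positivity
            nlinarith
      · have h4 : (1 / 2 : ℝ) ≤ r ^ s := by
          calc (1 / 2 : ℝ) = (1 / 2) ^ (1 : ℝ) := (Real.rpow_one _).symm
            _ ≤ (1 / 2) ^ s :=
              Real.rpow_le_rpow_of_exponent_ge (by norm_num) (by norm_num) h
            _ ≤ r ^ s := Real.rpow_le_rpow (by norm_num) (by linarith) h0
        calc (F.card : ℝ) ≤ 8 * 1 * (1 / 2) * M := by linarith
          _ ≤ _ := by gcongr
  · push Not at h
    rcases F.eq_empty_or_nonempty with h0 | ⟨t, ht⟩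
    · rw [h0, Finset.card_empty, Nat.cast_zero]; positivity
    · have h3 := hg_ds (r := δ) (F := {t}) hδ le_rfl hδ1 hds
        (Finset.singleton_subset_iff.2 (hFA ht)) ((t.1 : ℝ) * δ) ((t.2 : ℝ) * δ) (by
          intro q hq
          rw [Finset.mem_singleton] at hq
          subst hq
          simp [hδ])
      rw [Finset.card_singleton, Nat.cast_one] at h3
      have h4 := hg_line_card hδ hr F x y α (fun t ht => (hFm t ht).1)
        (fun t ht => hE t (hFA ht))
      have h5 : 1 ≤ C * δ ^ s * (2 * M) := h3.trans (by gcongr)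
      calc (F.card : ℝ) ≤ 27 * (r / δ) * 1 := by linarith
        _ ≤ 27 * (r / δ) * (C * δ ^ s * (2 * M)) := by gcongr
        _ = _ := by
          rw [Real.rpow_sub hδ, Real.rpow_one]; ring

/-- all scales are good. -/
def hgGood (n : ℕ) (c v : ℕ → ℝ) : Prop := ∀ k ∈ Finset.Icc 1 n, c k ≤ 2 * n * v k

lemma hg_markov {κ : Type*} (S : Finset κ) (n : ℕ) (hn : 1 ≤ n) (cnt : ℕ → κ → ℝ)
    (hcnt : ∀ k j, 0 ≤ cnt k j) (v : ℕ → ℝ) (hv : ∀ k ∈ Finset.Icc 1 n, 0 < v k)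
    (h : ∀ k ∈ Finset.Icc 1 n, ∑ j ∈ S, cnt k j ≤ v k * S.card) :
    (S.card : ℝ) ≤
      2 * ((S.filter fun j => hgGood n (fun k => cnt k j) v).card : ℕ) := by
  have hn0 : (0 : ℝ) < n := by exact_mod_cast hn
  have hbad : ∀ k ∈ Finset.Icc 1 n,
      (((S.filter fun j => ¬ cnt k j ≤ 2 * n * v k).card : ℕ) : ℝ) ≤ S.card / (2 * n) := by
    intro k hk
    have hvk := hv k hk
    have h1 : ((S.filter fun j => ¬ cnt k j ≤ 2 * n * v k).card : ℝ) * (2 * n * v k)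
        ≤ v k * S.card := by
      refine le_trans ?_ (h k hk)
      calc _ = ∑ j ∈ S.filter (fun j => ¬ cnt k j ≤ 2 * n * v k), (2 * n * v k) := by
            rw [Finset.sum_const, nsmul_eq_mul]
        _ ≤ ∑ j ∈ S.filter (fun j => ¬ cnt k j ≤ 2 * n * v k), cnt k j := by
            apply Finset.sum_le_sum
            intro j hj
            exact (not_le.1 (Finset.mem_filter.1 hj).2).le
        _ ≤ _ := Finset.sum_le_sum_of_subset_of_nonneg (Finset.filter_subset _ _)
            fun j _ _ => hcnt k j
    rw [le_div_iff₀ (by positivity)]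
    have : v k * (((S.filter fun j => ¬ cnt k j ≤ 2 * n * v k).card : ℝ) * (2 * n))
        ≤ v k * S.card := by linarith
    exact le_of_mul_le_mul_left this hvk
  have hsub : (S.filter fun j => ¬ hgGood n (fun k => cnt k j) v) ⊆
      (Finset.Icc 1 n).biUnion fun k => S.filter fun j => ¬ cnt k j ≤ 2 * n * v k := by
    intro j hj
    obtain ⟨hj1, hj2⟩ := Finset.mem_filter.1 hj
    unfold hgGood at hj2
    push Not at hj2
    obtain ⟨k, hk, hlt⟩ := hj2
    exact Finset.mem_biUnion.2 ⟨k, hk, Finset.mem_filter.2 ⟨hj1, not_le.2 hlt⟩⟩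
  have h2 := (Finset.card_le_card hsub).trans Finset.card_biUnion_le
  have h3 : ((S.filter fun j => ¬ hgGood n (fun k => cnt k j) v).card : ℝ)
      ≤ S.card / 2 := by
    calc _ ≤ ∑ k ∈ Finset.Icc 1 n,
          (((S.filter fun j => ¬ cnt k j ≤ 2 * n * v k).card : ℕ) : ℝ) := by exact_mod_cast h2
      _ ≤ ∑ k ∈ Finset.Icc 1 n, (S.card : ℝ) / (2 * n) := Finset.sum_le_sum hbad
      _ = _ := by
        rw [Finset.sum_const, Nat.card_Icc, nsmul_eq_mul]
        simp only [Nat.add_sub_cancel]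
        field_simp
  have h4 := Finset.card_filter_add_card_filter_not (s := S)
    (fun j => hgGood n (fun k => cnt k j) v)
  have h5 : ((S.filter fun j => hgGood n (fun k => cnt k j) v).card : ℝ)
      + (S.filter fun j => ¬ hgGood n (fun k => cnt k j) v).card = S.card := by
    exact_mod_cast h4
  linarith

/-- the incidence bound for a nice configuration. -/
lemma hg_V {δ R s t C M : ℝ} (n A : ℕ) (hδ : 0 < δ) (hδ1 : δ ≤ 1) (hA : δ * 2 ^ A = 1)
    (hR : 1 ≤ R) (hRn : 1 ≤ R ^ (2 * n) * δ) (hC : 1 ≤ C) (hst : 2 ≤ s + t)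
    {P P₀ : Finset (ℤ × ℤ)} (T0p : ℤ × ℤ → Finset (ℤ × ℤ))
    (hP : P ⊆ P₀) (hcard : P₀.card ≤ 4 ^ n * P.card) (hds : IsDSSet δ t C (sqUnion δ P₀))
    (hu : ∀ p ∈ P, sqInUnit δ p) (ht : ∀ p ∈ P, ∀ T ∈ T0p p, tubeIdx δ T)
    (hTds : ∀ p ∈ P, IsDSSet δ s C (sqUnion δ (T0p p)))
    (hM0 : 0 ≤ M) (hM1 : ∀ p ∈ P, M ≤ 2 * ((T0p p).card : ℝ))
    (hM2 : ∀ p ∈ P, ((T0p p).card : ℝ) ≤ 2 * M)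
    (hmeet : ∀ p ∈ P, ∀ T ∈ T0p p, (dTube δ T ∩ dSq δ p).Nonempty) :
    ∀ r, δ ≤ r → hlV P (P.sigma T0p) (fun q => (q.1 : ℝ) * δ) (fun q => (q.2 : ℝ) * δ)
      (fun j => (j.2.1 : ℝ) * δ) (fun j => (j.2.2 : ℝ) * δ) r
      ≤ (150002 * 2) ^ (2 * n) * (((A : ℝ) + 4) * (54 * 4 ^ (n + 1) * C ^ 2) * R ^ 2) * r
        * P.card * (P.sigma T0p).card := by
  intro r hr
  have hE : ∀ p ∈ P, ∀ T ∈ T0p p, |(p.2 : ℝ) * δ - (T.1 : ℝ) * δ * ((p.1 : ℝ) * δ)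
      - (T.2 : ℝ) * δ| ≤ 4 * δ := fun p hp T hT =>
    hg_E hδ (hu p hp) (ht p hp T hT) (hmeet p hp T hT)
  have ha : ∀ j ∈ P.sigma T0p, |(j.2.1 : ℝ) * δ| ≤ 1 := by
    intro j hj
    rw [Finset.mem_sigma] at hj
    exact hg_tub hδ (ht _ hj.1 _ hj.2)
  have hb : ∀ j ∈ P.sigma T0p, |(j.2.2 : ℝ) * δ| ≤ 4 := by
    intro j hj
    have ha' := abs_le.1 (ha j hj)
    rw [Finset.mem_sigma] at hj
    obtain ⟨z, ⟨ab, hab, hz⟩, hzp⟩ := hmeet _ hj.1 _ hj.2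
    have h1 := hg_mem hab
    have h3 := hu _ hj.1 hzp
    have h4 := h3.1.1
    have h5 := h3.1.2
    have h6 := h3.2.1
    have h7 := h3.2.2
    have h8 : ab.1 * z.1 ≤ 2 := by nlinarith [h1.1.2]
    have h9 : -1 ≤ ab.1 * z.1 := by nlinarith [h1.1.1]
    exact abs_le.2 ⟨by linarith [h1.2.2], by linarith [h1.2.1]⟩
  have h2A : (2 : ℝ) ^ (A + 3) * δ = 8 := by
    rw [pow_add]; linarith
  refine hl_induct P (P.sigma T0p) (fun q => (q.1 : ℝ) * δ) (fun q => (q.2 : ℝ) * δ)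
      (fun j => (j.2.1 : ℝ) * δ) (fun j => (j.2.2 : ℝ) * δ) (R := R)
      (Λ := 54 * 4 ^ (n + 1) * C ^ 2) (M := M) (β := hgBeta δ s C)
      (γ := fun w => 4 ^ (n + 1) * C * w ^ (min t 2)) hδ hR ?_ ha ?_ ?_ (A + 3) ?_ hM0 ?_ ?_ ?_ ?_ ?_
      ?_ ?_ (2 * n) r hr ?_
  · intro q hq
    have := hg_unit hδ (hu q hq)
    exact ⟨this.1.1, this.1.2.le⟩
  · intro w hw _
    have : 0 < w := hδ.trans_le hw
    positivity
  · intro w hw hw1 x y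
    exact hg_gam n hδ hC hP hcard hds hw hw1 x y
  · intro j hj j' hj'
    rw [h2A]
    have h1 := abs_le.1 (ha j hj)
    have h2 := abs_le.1 (ha j' hj')
    have h3 := abs_le.1 (hb j hj)
    have h4 := abs_le.1 (hb j' hj')
    exact ⟨abs_le.2 ⟨by linarith [h1.1, h2.2], by linarith [h1.2, h2.1]⟩,
      abs_le.2 ⟨by linarith [h3.1, h4.2], by linarith [h3.2, h4.1]⟩⟩
  · rw [Finset.card_sigma]
    push_cast
    rw [Finset.mul_sum, ← nsmul_eq_mul, ← Finset.sum_const]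
    exact Finset.sum_le_sum hM1
  · intro r hr
    have hβ0 : 0 ≤ hgBeta δ s C r * M :=
      mul_nonneg (hgBeta_nonneg hδ (by linarith) (hδ.le.trans hr)) hM0
    unfold hlN hlV
    rw [Finset.mul_sum]
    apply Finset.sum_le_sum
    intro j hj
    rw [Finset.card_filter, Finset.card_filter, Finset.sum_sigma]
    push_cast
    rw [Finset.mul_sum]
    apply Finset.sum_le_sum
    intro p hp
    have hcnt := hg_tube_count hδ hδ1 hC hr (T0p p) (hTds p hp) (hM2 p hp) ((p.1 : ℝ) * δ)
      ((p.2 : ℝ) * δ) ((j.2.1 : ℝ) * δ) ((j.2.2 : ℝ) * δ) (hE p hp)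
    rw [Finset.card_filter] at hcnt
    push_cast at hcnt
    split_ifs with hif
    · rw [mul_one]; exact hcnt
    · rw [mul_zero]
      apply le_of_eq
      apply Finset.sum_eq_zero
      intro T hT
      rw [if_neg]
      rintro ⟨h1, h2⟩
      apply hif
      have h3 := abs_le.1 (hE p hp T hT)
      have h4 := hg_unit hδ (hu p hp)
      have h5 : |((j.2.1 : ℝ) * δ - (T.1 : ℝ) * δ) * ((p.1 : ℝ) * δ)| ≤ r * 1 := by
        rw [abs_mul]
        exact mul_le_mul h1 (abs_le.2 ⟨by linarith [h4.1.1], h4.1.2.le⟩) (abs_nonneg _)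
          (hδ.le.trans hr)
      have h6 := abs_le.1 h5
      have h7 := abs_le.1 h2
      exact abs_le.2 ⟨by linarith [h3.1, h6.2, h7.2], by linarith [h3.2, h6.1, h7.1]⟩
  · intro r hr
    exact hgBeta_nonneg hδ (by linarith) (hδ.le.trans hr)
  · intro l w hl hw
    exact hgBeta_mul hδ (by linarith) (hδ.trans_le hw) hl
  · intro w hw hw1
    exact hg_lam n hδ (by linarith) hw hw1 hst
  · push_cast
    apply le_of_eq; ring
  · have h1 : (1 : ℝ) ≤ 4 ^ (n + 1) := one_le_pow₀ (by norm_num)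
    have h2 : (0 : ℝ) ≤ A := by positivity
    calc (1 : ℝ) ≤ (0 + 4) * (54 * 1 * 1 ^ 2) * 1 ^ 2 := by norm_num
      _ ≤ _ := by gcongr
  · refine hRn.trans ?_
    gcongr

lemma hg_card {δ : ℝ} (A : ℕ) (hδ : 0 < δ) (hA : δ * 2 ^ A = 1) (P : Finset (ℤ × ℤ))
    (hu : ∀ p ∈ P, sqInUnit δ p) : P.card ≤ 4 ^ A := by
  have hsub : P ⊆ (Finset.Ico (0 : ℤ) (2 ^ A)) ×ˢ (Finset.Ico (0 : ℤ) (2 ^ A)) := by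
    have key : ∀ i : ℤ, 0 ≤ (i : ℝ) * δ → (i : ℝ) * δ < 1 → i ∈ Finset.Ico (0 : ℤ) (2 ^ A) := by
      intro i h1 h2
      rw [Finset.mem_Ico]
      constructor
      · have : (0 : ℝ) ≤ i := by
          by_contra h; push Not at h; nlinarith
        exact_mod_cast this
      · have : (i : ℝ) < 2 ^ A := by
          by_contra h; push Not at h; nlinarith
        exact_mod_cast this
    intro p hp
    have := hg_unit hδ (hu p hp)
    exact Finset.mem_product.2 ⟨key _ this.1.1 this.1.2, key _ this.2.1 this.2.2⟩
  have := Finset.card_le_card hsub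
  rw [Finset.card_product, Int.card_Ico] at this
  refine this.trans (le_of_eq ?_)
  rw [sub_zero, show ((2 : ℤ) ^ A).toNat = 2 ^ A by
    rw [show ((2 : ℤ) ^ A) = ((2 ^ A : ℕ) : ℤ) by push_cast; rfl, Int.toNat_natCast], ← mul_pow]
  norm_num

/-- The counting core, with all scales made explicit. -/
lemma hg_core (n m : ℕ) (hn : 1 ≤ n) (hm : 1 ≤ m) {Δ δ s t C : ℝ} {M₀ : ℕ}
    (hΔ0 : 0 < Δ) (hΔ : Δ * 2 ^ m = 1) (hδd : δ = Δ ^ n) (P₀ T₀ : Finset (ℤ × ℤ))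
    (T0p : ℤ × ℤ → Finset (ℤ × ℤ)) (hst : 2 ≤ s + t) (hP₀ : P₀.Nonempty)
    (hnice : NiceConfig δ s C M₀ P₀ T₀ T0p) (hds : IsDSSet δ t C (sqUnion δ P₀)) :
    ∃ (P : Finset (ℤ × ℤ)) (Tp : ℤ × ℤ → Finset (ℤ × ℤ)),
      P ⊆ P₀ ∧ (P₀.card : ℝ) ≤ 4 ^ n * P.card ∧ (∀ p ∈ P, Tp p ⊆ T0p p) ∧
      (P₀.card : ℝ) * M₀ ≤ 4 ^ (n + 1) * ∑ p ∈ P, ((Tp p).card : ℝ) ∧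
      ∀ k : ℕ, 1 ≤ k → k ≤ n → ∀ p ∈ P, ∀ T ∈ Tp p,
        (Nat.card {Q : ℤ × ℤ | (dSq (Δ ^ k) Q ∩ sqUnion δ P).Nonempty ∧
            dSq (Δ ^ k) Q ⊆ nbTube 6 (Δ ^ k) (parQ ((2 : ℤ) ^ (m * (n - k))) T)} : ℝ)
          ≤ ((m * n : ℕ) : ℝ) * (2 * n * ((150002 * 2) ^ (2 * n) *
              ((((m * n : ℕ) : ℝ) + 4) * (54 * 4 ^ (n + 1) * C ^ 2) * Δ⁻¹))) *
              (covNum (Δ ^ k) (sqUnion δ P) : ℝ) * Δ ^ k := by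
  have hδ : 0 < δ := by rw [hδd]; positivity
  have hΔ1 : Δ ≤ 1 := by
    have : (1 : ℝ) ≤ 2 ^ m := one_le_pow₀ (by norm_num)
    nlinarith
  have hδ1 : δ ≤ 1 := by rw [hδd]; exact pow_le_one₀ hΔ0.le hΔ1
  have hA : δ * 2 ^ (m * n) = 1 := by
    rw [hδd, pow_mul, ← mul_pow, hΔ, one_pow]
  obtain ⟨hu, htub, hT⟩ := hnice
  have hP₀c : (0 : ℝ) < P₀.card := by exact_mod_cast Finset.card_pos.2 hP₀
  have hC : 1 ≤ C := by
    have := hg_ds (r := 1) (F := P₀) hδ hδ1 le_rfl hds le_rfl (1 / 2) (1 / 2) (by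
      intro q hq
      have h := hg_unit hδ (hu q hq)
      exact ⟨abs_lt.2 ⟨by linarith [h.1.1], by linarith [h.1.2]⟩,
        abs_lt.2 ⟨by linarith [h.2.1], by linarith [h.2.2]⟩⟩)
    rw [Real.one_rpow, mul_one] at this
    exact le_of_mul_le_mul_right (by linarith) hP₀c
  have hmn : 1 ≤ m * n := Nat.mul_pos hm hn
  obtain ⟨P, hP, hPne, hcard, hfib⟩ := hg_prune P₀ hP₀ n (m * n) hmn
    (fun k => parQ ((2 : ℤ) ^ (m * (n - (k + 1))))) (hg_card _ hδ hA P₀ hu)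
  have hcR : (P₀.card : ℝ) ≤ 4 ^ n * P.card := by exact_mod_cast hcard
  have hPc : (0 : ℝ) < P.card := by exact_mod_cast Finset.card_pos.2 hPne
  set R := Real.sqrt Δ⁻¹ with hRd
  have hΔi : 1 ≤ Δ⁻¹ := (one_le_inv₀ hΔ0).2 hΔ1
  have hR : 1 ≤ R := Real.one_le_sqrt.2 hΔi
  have hR2 : R ^ 2 = Δ⁻¹ := Real.sq_sqrt (by positivity)
  have hRn : 1 ≤ R ^ (2 * n) * δ := by
    rw [pow_mul, hR2, hδd, ← mul_pow, inv_mul_cancel₀ hΔ0.ne', one_pow]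
  have hV := hg_V (M := (M₀ : ℝ)) n (m * n) hδ hδ1 hA hR hRn hC hst T0p hP hcard hds
    (fun p hp => hu p (hP hp)) (fun p hp T hT' => htub _ ((hT p (hP hp)).1 hT'))
    (fun p hp => (hT p (hP hp)).2.1) (by positivity) (fun p hp => (hT p (hP hp)).2.2.1)
    (fun p hp => (hT p (hP hp)).2.2.2.1) (fun p hp => (hT p (hP hp)).2.2.2.2)
  rw [hR2] at hV
  set G : ℝ := (150002 * 2) ^ (2 * n) *
      ((((m * n : ℕ) : ℝ) + 4) * (54 * 4 ^ (n + 1) * C ^ 2) * Δ⁻¹) with hG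
  have hG0 : 0 < G := by positivity
  have hmk := hg_markov (P.sigma T0p) n hn
    (fun k j => (((P.filter fun q => |(q.2 : ℝ) * δ - (j.2.1 : ℝ) * δ * ((q.1 : ℝ) * δ)
      - (j.2.2 : ℝ) * δ| ≤ 32 * Δ ^ k).card : ℕ) : ℝ))
    (fun k j => by positivity) (fun k => G * Δ ^ k * P.card)
    (fun k _ => by positivity) (by
      intro k hk
      exact hV (Δ ^ k) (by
        rw [hδd]; exact pow_le_pow_of_le_one hΔ0.le hΔ1 (Finset.mem_Icc.1 hk).2))
  set Tp : ℤ × ℤ → Finset (ℤ × ℤ) := fun p => (T0p p).filter fun T => hgGood n (fun k =>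
    (((P.filter fun q => |(q.2 : ℝ) * δ - (T.1 : ℝ) * δ * ((q.1 : ℝ) * δ)
      - (T.2 : ℝ) * δ| ≤ 32 * Δ ^ k).card : ℕ) : ℝ)) (fun k => G * Δ ^ k * P.card) with hTp
  refine ⟨P, Tp, hP, hcR, fun p _ => Finset.filter_subset _ _, ?_, ?_⟩
  · have h1 : (((P.sigma T0p).filter fun j => hgGood n (fun k =>
        (((P.filter fun q => |(q.2 : ℝ) * δ - (j.2.1 : ℝ) * δ * ((q.1 : ℝ) * δ)
      - (j.2.2 : ℝ) * δ| ≤ 32 * Δ ^ k).card : ℕ) : ℝ)) (fun k => G * Δ ^ k * P.card)).card : ℝ)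
        = ∑ p ∈ P, ((Tp p).card : ℝ) := by
      rw [← Nat.cast_sum, ← Finset.card_sigma]
      congr 2
      ext ⟨p, T⟩
      simp only [hTp, Finset.mem_filter, Finset.mem_sigma, and_assoc]
    rw [h1] at hmk
    have h2 : (P.card : ℝ) * M₀ ≤ 2 * ((P.sigma T0p).card : ℝ) := by
      rw [Finset.card_sigma]
      push_cast
      rw [Finset.mul_sum, ← nsmul_eq_mul, ← Finset.sum_const]
      exact Finset.sum_le_sum fun p hp => (hT p (hP hp)).2.2.1
    calc (P₀.card : ℝ) * M₀ ≤ 4 ^ n * P.card * M₀ := by gcongr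
      _ = 4 ^ n * (P.card * M₀) := by ring
      _ ≤ 4 ^ n * (4 * ∑ p ∈ P, ((Tp p).card : ℝ)) := by
        refine mul_le_mul_of_nonneg_left ?_ (by positivity)
        linarith
      _ = _ := by rw [pow_succ]; ring
  · intro k hk1 hkn p hp T hTm
    simp only [hTp, Finset.mem_filter] at hTm
    have hcnt := hTm.2 k (Finset.mem_Icc.2 ⟨hk1, hkn⟩)
    have hTt : tubeIdx δ T := htub _ ((hT p (hP hp)).1 hTm.1)
    set S : ℤ := (2 : ℤ) ^ (m * (n - k)) with hSd
    have hS : 0 < S := by positivity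
    have hw : (S : ℝ) * δ = Δ ^ k := by
      rw [hSd, hδd]
      push_cast
      rw [pow_mul, show Δ ^ n = Δ ^ (n - k) * Δ ^ k by rw [← pow_add]; congr 1; omega,
        ← mul_assoc, ← mul_pow, mul_comm _ Δ, hΔ, one_pow, one_mul]
    have hw1 : (S : ℝ) * δ ≤ 1 := by rw [hw]; exact pow_le_one₀ hΔ0.le hΔ1
    have hfk := hfib (k - 1) (by omega)
    rw [show k - 1 + 1 = k by omega, ← hSd] at hfk
    rw [← hw, hg_par_cov hδ hS]
    set W : Finset (ℤ × ℤ) := (P.image (parQ S)).filter fun Q =>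
      dSq (S * δ) Q ⊆ nbTube 6 (S * δ) (parQ S T) with hWd
    have hset : {Q : ℤ × ℤ | (dSq (S * δ) Q ∩ sqUnion δ P).Nonempty ∧
        dSq (S * δ) Q ⊆ nbTube 6 (S * δ) (parQ S T)} = (W : Set (ℤ × ℤ)) := by
      ext Q
      rw [hWd, Finset.coe_filter, Set.mem_ofPred_eq, Set.mem_ofPred_eq, hg_par_meet hδ hS]
    rw [hset, Nat.card_coe_set_eq, Set.ncard_coe_finset]
    set D : ℝ := ((P.image (parQ S)).card : ℝ) with hDd
    have h1 : (W.card : ℝ) * P.card ≤ ((m * n : ℕ) : ℝ) * D *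
        ((P.filter fun q => |(q.2 : ℝ) * δ - (T.1 : ℝ) * δ * ((q.1 : ℝ) * δ)
          - (T.2 : ℝ) * δ| ≤ 32 * Δ ^ k).card : ℕ) := by
      calc (W.card : ℝ) * P.card = ∑ Q ∈ W, (P.card : ℝ) := by
            rw [Finset.sum_const, nsmul_eq_mul]
        _ ≤ ∑ Q ∈ W, ((m * n : ℕ) : ℝ) * D * (P.filter fun q => parQ S q = Q).card := by
            apply Finset.sum_le_sum
            intro Q hQ
            exact hfk Q (Finset.mem_filter.1 hQ).1
        _ = ((m * n : ℕ) : ℝ) * D * (∑ Q ∈ W, (P.filter fun q => parQ S q = Q).card : ℕ) := by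
            rw [← Finset.mul_sum, Nat.cast_sum]
        _ ≤ _ := by
            gcongr
            rw [← Finset.card_biUnion]
            · apply Finset.card_le_card
              intro q hq
              obtain ⟨Q, hQ, hq2⟩ := Finset.mem_biUnion.1 hq
              rw [Finset.mem_filter] at hq2 ⊢
              refine ⟨hq2.1, ?_⟩
              rw [← hw]
              exact hg_final hδ hS hw1 (hu q (hP hq2.1)) hTt hq2.2 (Finset.mem_filter.1 hQ).2
            · intro Q _ Q' _ hne
              change Disjoint _ _
              rw [Finset.disjoint_left]
              intro q hq hq'
              exact hne ((Finset.mem_filter.1 hq).2.symm.trans (Finset.mem_filter.1 hq').2)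
    have h2 : (W.card : ℝ) * P.card ≤
        (((m * n : ℕ) : ℝ) * (2 * n * G) * D * (S * δ)) * P.card := by
      rw [hw]
      calc _ ≤ ((m * n : ℕ) : ℝ) * D * (2 * n * (G * Δ ^ k * P.card)) := by
            refine h1.trans ?_
            gcongr
        _ = _ := by ring
    exact le_of_mul_le_mul_right h2 hPc

/-- **The case `s + t ≥ 2`.** Fix `Δ < Δ₀`, `n ∈ ℕ` and `δ = Δⁿ`.  Any
`(δ, s, C₀, M₀)`-nice configuration `(𝒫₀, 𝒯₀)` with `𝒫₀` a `(δ, t, C₀)`-set and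
`s + t ≥ 2` has a refinement `(𝒫, 𝒯)` such that for all `1 ≤ k ≤ n`, `T ∈ 𝒯`,
`w = Δᵏ` and `ε ∈ (0, 1/n]`, the number of dyadic `w`-squares of `𝒟_w(𝒫)`
contained in `6(T^w)` is at most
`C_ε (log 1/δ)^C · C₀² Δ^{−1} · |𝒫|_w · w^{1−ε}`. -/
theorem case_s_plus_t_ge_two :
    ∃ Δ₀ > (0 : ℝ), Δ₀ < 1 ∧
    ∀ n : ℕ, 1 ≤ n → ∀ ε : ℝ, 0 < ε → ε ≤ 1 / (n : ℝ) →
    ∃ C > (0 : ℝ),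
    ∀ (m : ℕ), 1 ≤ m → ∀ (Δ δ : ℝ), Δ = 2 ^ (-(m : ℤ)) → Δ < Δ₀ → δ = Δ ^ n →
    ∀ (s t C₀ : ℝ) (M₀ : ℕ) (P₀ T₀ : Finset (ℤ × ℤ)) (T0p : ℤ × ℤ → Finset (ℤ × ℤ)),
      2 ≤ s + t → 0 < C₀ → P₀.Nonempty →
      NiceConfig δ s C₀ M₀ P₀ T₀ T0p → IsDSSet δ t C₀ (sqUnion δ P₀) →
      ∃ (P : Finset (ℤ × ℤ)) (Tp : ℤ × ℤ → Finset (ℤ × ℤ)),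
        IsRefinementC C δ (M₀ : ℝ) P₀ T0p P Tp ∧
        ∀ k : ℕ, 1 ≤ k → k ≤ n → ∀ p ∈ P, ∀ T ∈ Tp p,
          (Nat.card {Q : ℤ × ℤ | (dSq (Δ ^ k) Q ∩ sqUnion δ P).Nonempty ∧
              dSq (Δ ^ k) Q ⊆ nbTube 6 (Δ ^ k) (parQ ((2 : ℤ) ^ (m * (n - k))) T)} : ℝ)
            ≤ C * (Real.log δ⁻¹) ^ C * C₀ ^ 2 * Δ⁻¹ *
                (covNum (Δ ^ k) (sqUnion δ P) : ℝ) * (Δ ^ k) ^ (1 - ε) := by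
  refine ⟨1 / 2, by norm_num, by norm_num, ?_⟩
  intro n hn ε hε _
  set c : ℝ := 2 * n * ((150002 * 2) ^ (2 * n) * (5 * (54 * 4 ^ (n + 1)))) with hc
  have hn0 : (0 : ℝ) < n := by exact_mod_cast hn
  have hc0 : 0 < c := by positivity
  refine ⟨4 * c + 4 ^ (n + 1) + 2, by positivity, ?_⟩
  set C : ℝ := 4 * c + 4 ^ (n + 1) + 2 with hC
  intro m hm1 Δ δ hΔd hΔ2 hδd s t C₀ M₀ P₀ T₀ T0p hst hC₀ hP₀ hnice hds
  have h4 : (0 : ℝ) < 4 ^ (n + 1) := by positivity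
  have hΔ0 : 0 < Δ := by rw [hΔd]; positivity
  have hΔ : Δ * 2 ^ m = 1 := by
    rw [hΔd, zpow_neg, zpow_natCast]
    exact inv_mul_cancel₀ (by positivity)
  have hm2 : 2 ≤ m := by
    by_contra h
    have : m = 1 := by omega
    subst this
    linarith
  obtain ⟨P, Tp, hP, hcard, hTp, hsum, hcount⟩ :=
    hg_core n m hn hm1 hΔ0 hΔ hδd P₀ T₀ T0p hst hP₀ hnice hds
  have hΔ1 : Δ ≤ 1 := by linarith
  have hA2 : (2 : ℝ) ≤ ((m * n : ℕ) : ℝ) := by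
    have : 2 * 1 ≤ m * n := Nat.mul_le_mul hm2 hn
    exact_mod_cast this
  have hl2 : (1 / 2 : ℝ) ≤ Real.log 2 := by linarith [Real.log_two_gt_d9]
  have hlog : Real.log δ⁻¹ = ((m * n : ℕ) : ℝ) * Real.log 2 := by
    have : δ⁻¹ = 2 ^ (m * n) := by
      rw [inv_eq_iff_eq_inv]
      rw [hδd, hΔd, zpow_neg, zpow_natCast, inv_pow, ← pow_mul]
    rw [this, Real.log_pow]
  set l := Real.log δ⁻¹ with hl
  set A : ℝ := ((m * n : ℕ) : ℝ) with hA
  have hAl : A ≤ 2 * l := by rw [hlog]; nlinarith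
  have hl1 : 1 ≤ l := by linarith
  have hlC : l ^ 2 ≤ l ^ C := by
    rw [← Real.rpow_two]
    exact Real.rpow_le_rpow_of_exponent_le hl1 (by linarith)
  have hlC1 : 1 ≤ l ^ C := by nlinarith
  have hCl : 4 ^ (n + 1) ≤ C * l ^ C := by nlinarith
  have hCl' : (4 : ℝ) ^ n ≤ C * l ^ C := by
    refine le_trans ?_ hCl
    exact pow_le_pow_right₀ (by norm_num) (by omega)
  refine ⟨P, Tp, ⟨hP, hcard.trans ?_, hTp, hsum.trans ?_⟩, ?_⟩
  · exact mul_le_mul_of_nonneg_right hCl' (by positivity)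
  · exact mul_le_mul_of_nonneg_right hCl (Finset.sum_nonneg fun p _ => by positivity)
  · intro k hk1 hkn p hp T hT
    refine (hcount k hk1 hkn p hp T hT).trans ?_
    have hw0 : 0 < Δ ^ k := by positivity
    have hw1 : Δ ^ k ≤ 1 := pow_le_one₀ hΔ0.le hΔ1
    have hww : Δ ^ k ≤ (Δ ^ k) ^ (1 - ε) := by
      have := Real.rpow_le_rpow_of_exponent_ge hw0 hw1 (show 1 - ε ≤ 1 by linarith)
      rwa [Real.rpow_one] at this
    have hkey : A * (A + 4) * (2 * n * ((150002 * 2) ^ (2 * n) * (54 * 4 ^ (n + 1))))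
        ≤ C * l ^ C := by
      set e : ℝ := 2 * n * ((150002 * 2) ^ (2 * n) * (54 * 4 ^ (n + 1))) with he
      have he0 : 0 < e := by positivity
      have hce : c = 5 * e := by rw [hc, he]; ring
      have hA5 : A * (A + 4) ≤ 20 * l ^ 2 := by nlinarith
      calc A * (A + 4) * e ≤ 20 * l ^ 2 * e := by gcongr
        _ = (4 * c) * l ^ 2 := by rw [hce]; ring
        _ ≤ C * l ^ C := by
          have : 4 * c ≤ C := by linarith
          gcongr
    set d : ℝ := (covNum (Δ ^ k) (sqUnion δ P) : ℝ) with hd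
    have hd0 : 0 ≤ d := by positivity
    calc _ = (A * (A + 4) * (2 * n * ((150002 * 2) ^ (2 * n) * (54 * 4 ^ (n + 1))))) * C₀ ^ 2
          * Δ⁻¹ * d * Δ ^ k := by ring
      _ ≤ _ := by gcongr

end
end
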